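/- Assume the Riemann hypothesis. Then there exists A > 0 such that for all sufficiently large T the open interval (T, T + 2A/ln(ln T)) contains a root of odd order of Z'(t) = 0; in particular there exist t₁ < t₂ in (T, T + 2A/ln(ln T)) with Z'(t₁)·Z'(t₂) < 0. -/

import Mathlib

open Filter Topology

noncomputable def theta (t : ℝ) : ℝ :=
  (Complex.log (Complex.Gamma (1/4 + Complex.I * t / 2))).im - t / 2 * Real.log Real.pi

noncomputable def hardyZ (t : ℝ) : ℝ :=
  (Complex.exp (Complex.I * theta t) * riemannZeta (1/2 + Complex.I * t)).re

/-- A nonzero entire function is `(z - a) ^ k` times an entire function not vanishing at `a`. -/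
lemma exists_eq_sub_pow_mul_of_entire {f : ℂ → ℂ} (hf : Differentiable ℂ f) (hne : ∃ z, f z ≠ 0)
    (a : ℂ) : ∃ (k : ℕ) (g : ℂ → ℂ), Differentiable ℂ g ∧ g a ≠ 0 ∧
      ∀ z, f z = (z - a) ^ k * g z := by
  have hev : ¬ ∀ᶠ z in 𝓝 a, f z = 0 := by
    intro h
    obtain ⟨w, hw⟩ := hne
    have hz := AnalyticOnNhd.eqOn_zero_of_preconnected_of_eventuallyEq_zero
      (fun z _ => hf.analyticAt z) isPreconnected_univ (Set.mem_univ a) h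
    exact hw (hz (Set.mem_univ w))
  obtain ⟨k, g, hga, hg0, hfg⟩ :=
    (hf.analyticAt a).exists_eventuallyEq_pow_smul_nonzero_iff.mpr hev
  have hga' := Complex.analyticAt_iff_eventually_differentiableAt.mp hga
  refine ⟨k, fun z => if z = a then g a else f z / (z - a) ^ k, ?_, by simpa using hg0, ?_⟩
  · intro z
    by_cases hz : z = a
    · subst hz
      refine (hga.differentiableAt).congr_of_eventuallyEq ?_
      filter_upwards [hfg] with w hw
      by_cases hwz : w = z
      · simp [hwz]
      · have : w - z ≠ 0 := sub_ne_zero.mpr hwz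
        simp only [hwz, if_false, hw, smul_eq_mul]
        field_simp
    · have hd : DifferentiableAt ℂ (fun w => f w / (w - a) ^ k) z := by
        have : (z - a) ^ k ≠ 0 := pow_ne_zero _ (sub_ne_zero.mpr hz)
        exact (hf z).div (by fun_prop) this
      refine hd.congr_of_eventuallyEq ?_
      filter_upwards [isOpen_ne.mem_nhds hz] with w hw
      simp [show w ≠ a from hw]
  · intro z
    by_cases hz : z = a
    · subst hz
      simpa using hfg.self_of_nhds
    · have : (z - a) ^ k ≠ 0 := pow_ne_zero _ (sub_ne_zero.mpr hz)
      simp only [hz, if_false]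
      field_simp

/-- Finitely many zeros can be divided out of an entire function. -/
lemma exists_eq_prod_mul_of_entire {f : ℂ → ℂ} (hf : Differentiable ℂ f) (hne : ∃ z, f z ≠ 0)
    (S : Finset ℂ) : ∃ (m : ℂ → ℕ) (E : ℂ → ℂ), Differentiable ℂ E ∧ (∀ ρ ∈ S, E ρ ≠ 0) ∧
      ∀ z, f z = (∏ ρ ∈ S, (z - ρ) ^ m ρ) * E z := by
  classical
  induction S using Finset.induction_on with
  | empty => exact ⟨0, f, hf, by simp, by simp⟩
  | insert a S ha ih =>
    obtain ⟨m, E, hE, hES, hfE⟩ := ih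
    have hEne : ∃ z, E z ≠ 0 := by
      obtain ⟨z, hz⟩ := hne
      exact ⟨z, fun h => hz (by rw [hfE, h, mul_zero])⟩
    obtain ⟨k, g, hg, hga, hEg⟩ := exists_eq_sub_pow_mul_of_entire hE hEne a
    refine ⟨Function.update m a k, g, hg, ?_, ?_⟩
    · intro ρ hρ
      rcases Finset.mem_insert.mp hρ with rfl | hρ
      · exact hga
      · intro h
        exact hES ρ hρ (by rw [hEg, h, mul_zero])
    · intro z
      rw [Finset.prod_insert ha, hfE, hEg, Function.update_self]
      have : ∏ ρ ∈ S, (z - ρ) ^ Function.update m a k ρ = ∏ ρ ∈ S, (z - ρ) ^ m ρ := by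
        refine Finset.prod_congr rfl fun ρ hρ => ?_
        rw [Function.update_of_ne (by rintro rfl; exact ha hρ)]
      rw [this]
      ring

/-- A zero-free holomorphic function on a disc has a holomorphic logarithm. -/
lemma exists_log_on_ball {G : ℂ → ℂ} {R : ℝ} (hR : 0 < R)
    (hG : DifferentiableOn ℂ G (Metric.ball 0 R)) (hne : ∀ z ∈ Metric.ball (0 : ℂ) R, G z ≠ 0)
    (h0 : G 0 = 1) : ∃ l : ℂ → ℂ, DifferentiableOn ℂ l (Metric.ball 0 R) ∧ l 0 = 0 ∧
      ∀ z ∈ Metric.ball (0 : ℂ) R, Complex.exp (l z) = G z := by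
  have hd : DifferentiableOn ℂ (fun z => deriv G z / G z) (Metric.ball 0 R) :=
    (hG.deriv Metric.isOpen_ball).div hG hne
  obtain ⟨p, hp⟩ := hd.isExactOn_ball
  have hmem : (0 : ℂ) ∈ Metric.ball (0 : ℂ) R := Metric.mem_ball_self hR
  refine ⟨fun z => p z - p 0, fun z hz => ?_, by simp, ?_⟩
  · exact ((hp z hz).differentiableAt.sub_const _).differentiableWithinAt
  · have hder : ∀ z ∈ Metric.ball (0 : ℂ) R,
        HasDerivAt (fun z => Complex.exp (-(p z - p 0)) * G z) 0 z := by
      intro z hz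
      have hGz : HasDerivAt G (deriv G z) z :=
        ((hG z hz).differentiableAt (Metric.isOpen_ball.mem_nhds hz)).hasDerivAt
      have h1 := (((hp z hz).sub_const (p 0)).neg.cexp).mul hGz
      refine h1.congr_deriv ?_
      have := hne z hz
      rw [mul_neg, neg_mul, mul_assoc, div_mul_cancel₀ _ this, neg_add_cancel]
    intro z hz
    have hc := IsOpen.is_const_of_deriv_eq_zero Metric.isOpen_ball
      (convex_ball (0 : ℂ) R).isPreconnected
      (fun w hw => (hder w hw).differentiableAt.differentiableWithinAt)
      (fun w hw => (hder w hw).deriv) hz hmem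
    simp only [sub_self, neg_zero, Complex.exp_zero, h0, mul_one] at hc
    rw [Complex.exp_neg] at hc
    exact (inv_mul_eq_one₀ (Complex.exp_ne_zero _)).mp hc

/-- The even part of a holomorphic function vanishing at the centre of a disc is quadratically
small, in terms of a one-sided bound for the real part. -/
lemma norm_add_neg_le_of_re_le {l : ℂ → ℂ} {R M : ℝ} (hR : 0 < R) (hM : 0 < M)
    (hl : DifferentiableOn ℂ l (Metric.ball 0 R)) (hl0 : l 0 = 0)
    (hre : ∀ z ∈ Metric.ball (0 : ℂ) R, (l z).re ≤ M) {z : ℂ} (hz : ‖z‖ < R / 8) :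
    ‖l z + l (-z)‖ ≤ 128 * M / R ^ 2 * ‖z‖ ^ 2 := by
  have hb : ∀ w : ℂ, ‖w‖ < R / 2 → ‖l w‖ ≤ 2 * M := by
    intro w hw
    have h := Complex.borelCaratheodory_zero hM hl hre hR
      (z := w) (by simpa using hw.trans (by linarith)) hl0
    refine h.trans ?_
    rw [div_le_iff₀ (by linarith)]
    nlinarith [norm_nonneg w]
  set h : ℂ → ℂ := fun w => l w + l (-w) with hh
  have hdl : ∀ w : ℂ, ‖w‖ < R → DifferentiableAt ℂ l w := fun w hw =>
    (hl w (by simpa using hw)).differentiableAt (Metric.isOpen_ball.mem_nhds (by simpa using hw))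
  have hdh : ∀ w : ℂ, ‖w‖ < R → DifferentiableAt ℂ h w := by
    intro w hw
    have h1 : DifferentiableAt ℂ (fun w => l (-w)) w :=
      DifferentiableAt.comp w (hdl (-w) (by simpa using hw)) (by fun_prop)
    exact (hdl w hw).add h1
  have hdh' : DifferentiableOn ℂ h (Metric.ball 0 R) := fun w hw =>
    (hdh w (by simpa using hw)).differentiableWithinAt
  have hddh := hdh'.deriv Metric.isOpen_ball
  have hbh : ∀ w : ℂ, ‖w‖ < R / 2 → ‖h w‖ ≤ 4 * M := by
    intro w hw
    have := norm_add_le (l w) (l (-w))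
    have h1 := hb w hw
    have h2 := hb (-w) (by simpa using hw)
    simp only [hh]
    linarith
  have hsub : ∀ (w : ℂ) (r s : ℝ), ‖w‖ < r → r + s ≤ R → 0 < s →
      Metric.closedBall w s ⊆ Metric.ball 0 R := by
    intro w r s hw hrs hs v hv
    have : ‖v‖ ≤ ‖w‖ + ‖v - w‖ := by simpa using norm_add_le w (v - w)
    simp only [Metric.mem_closedBall, dist_eq_norm] at hv
    simp only [Metric.mem_ball, dist_zero_right]
    linarith
  have hsph : ∀ (w v : ℂ) (s : ℝ), v ∈ Metric.sphere w s → ‖v‖ ≤ ‖w‖ + s := by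
    intro w v s hv
    have : ‖v‖ ≤ ‖w‖ + ‖v - w‖ := by simpa using norm_add_le w (v - w)
    simp only [Metric.mem_sphere, dist_eq_norm] at hv
    linarith
  have hb1 : ∀ w : ℂ, ‖w‖ < R / 4 → ‖deriv h w‖ ≤ 16 * M / R := by
    intro w hw
    have := Complex.norm_deriv_le_of_forall_mem_sphere_norm_le (c := w) (R := R / 4) (C := 4 * M)
      (f := h) (by linarith)
      ((hdh'.mono (hsub w _ _ hw (by linarith) (by linarith))).diffContOnCl_ball subset_rfl)
      (fun v hv => hbh v (by linarith [hsph w v _ hv]))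
    refine this.trans (le_of_eq ?_)
    field_simp
    ring
  have hb2 : ∀ w : ℂ, ‖w‖ < R / 8 → ‖deriv (deriv h) w‖ ≤ 128 * M / R ^ 2 := by
    intro w hw
    have := Complex.norm_deriv_le_of_forall_mem_sphere_norm_le (c := w) (R := R / 8)
      (C := 16 * M / R) (f := deriv h) (by linarith)
      ((hddh.mono (hsub w _ _ hw (by linarith) (by linarith))).diffContOnCl_ball subset_rfl)
      (fun v hv => hb1 v (by linarith [hsph w v _ hv]))
    refine this.trans (le_of_eq ?_)
    field_simp
    ring
  have hd0 : deriv h 0 = 0 := by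
    have h1 : HasDerivAt l (deriv l 0) 0 := (hdl 0 (by simpa using hR)).hasDerivAt
    have h2 : HasDerivAt (fun w => l (-w)) (deriv l 0 * (-1)) 0 := by
      have h1' : HasDerivAt l (deriv l 0) (-0) := by simpa using h1
      exact h1'.comp (0 : ℂ) (hasDerivAt_neg (0 : ℂ))
    have h3 : HasDerivAt h (deriv l 0 + deriv l 0 * (-1)) 0 := h1.add h2
    simpa using h3.deriv
  have hK : 0 ≤ 128 * M / R ^ 2 := by positivity
  have hR8 : 0 < R / 8 := by linarith
  have hb3 : ∀ w : ℂ, ‖w‖ < R / 8 → ‖deriv h w‖ ≤ 128 * M / R ^ 2 * ‖w‖ := by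
    intro w hw
    have := Convex.norm_image_sub_le_of_norm_deriv_le (f := deriv h)
      (s := Metric.ball (0 : ℂ) (R / 8)) (x := 0) (y := w) (C := 128 * M / R ^ 2)
      (fun v hv => by
        have hv' : v ∈ Metric.ball (0 : ℂ) R :=
          Metric.ball_subset_ball (by linarith) hv
        exact (hddh v hv').differentiableAt (Metric.isOpen_ball.mem_nhds hv'))
      (fun v hv => hb2 v (by simpa using hv)) (convex_ball _ _) (Metric.mem_ball_self hR8)
      (by simpa using hw)
    simpa [hd0] using this
  have := Convex.norm_image_sub_le_of_norm_deriv_le (f := h)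
      (s := Metric.closedBall (0 : ℂ) ‖z‖) (x := 0) (y := z) (C := 128 * M / R ^ 2 * ‖z‖)
      (fun v hv => hdh v (by
        simp only [Metric.mem_closedBall, dist_zero_right] at hv
        linarith))
      (fun v hv => by
        simp only [Metric.mem_closedBall, dist_zero_right] at hv
        exact (hb3 v (hv.trans_lt hz)).trans (by gcongr)) (convex_closedBall _ _)
      (by simp) (by simp)
  have h00 : h 0 = 0 := by simp [hh, hl0]
  rw [h00] at this
  simpa [hh, pow_two, mul_assoc] using this

lemma finite_zeros_in_closedBall {f : ℂ → ℂ} (hf : Differentiable ℂ f) (hne : ∃ z, f z ≠ 0)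
    (R : ℝ) : (Metric.closedBall (0 : ℂ) R ∩ {z | f z = 0}).Finite := by
  obtain ⟨x, hx⟩ := hne
  have h := AnalyticOnNhd.preimage_zero_mem_codiscrete (f := f) (x := x)
    (fun z _ => hf.analyticAt z) hx
  have h' := mem_codiscrete'.mp h
  have hc : IsClosed {z | f z = 0} := isClosed_eq hf.continuous continuous_const
  refine ((isCompact_closedBall (0 : ℂ) R).inter_right hc).finite ?_
  refine IsDiscrete.mono ?_ Set.inter_subset_right
  have h2 := h'.2
  have : (f ⁻¹' {0}ᶜ)ᶜ = {z | f z = 0} := by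
    ext z
    simp
  rwa [this] at h2

/-- For a purely imaginary `ρ`, the quantity `|z - ρ| |z + ρ|` increases with `|Re z|`. -/
lemma norm_sub_mul_neg_sub_mono {ρ z w : ℂ} (hρ : ρ.re = 0) (him : z.im = w.im)
    (h0 : 0 ≤ z.re) (hle : z.re ≤ w.re) : ‖(z - ρ) * (-z - ρ)‖ ≤ ‖(w - ρ) * (-w - ρ)‖ := by
  rw [norm_mul, norm_mul]
  have key : ∀ σ : ℝ, ‖(z.re : ℂ) + σ * Complex.I‖ ≤ ‖(w.re : ℂ) + σ * Complex.I‖ := by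
    intro σ
    rw [Complex.norm_add_mul_I, Complex.norm_add_mul_I]
    apply Real.sqrt_le_sqrt
    nlinarith
  have e1 : ∀ v : ℂ, v - ρ = (v.re : ℂ) + ((v.im - ρ.im : ℝ) : ℂ) * Complex.I := by
    intro v
    apply Complex.ext <;> simp [hρ]
  have e2 : ∀ v : ℂ, -v - ρ = -((v.re : ℂ) + ((v.im + ρ.im : ℝ) : ℂ) * Complex.I) := by
    intro v
    apply Complex.ext <;> simp [hρ]
    ring
  rw [e1 z, e1 w, e2 z, e2 w, norm_neg, norm_neg, him]
  exact mul_le_mul (key _) (key _) (norm_nonneg _) (norm_nonneg _)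

/-- Dividing out the zeros in a disc of radius `R` costs nothing in the growth bound. -/
lemma norm_mul_neg_le_mul_exp {g : ℂ → ℂ} (hg : Differentiable ℂ g) (h0 : g 0 ≠ 0)
    (hzero : ∀ ρ, g ρ = 0 → ρ.re = 0) {R M : ℝ} (hR : 0 < R) (hM : 0 < M)
    (hbd : ∀ z, ‖z‖ = 4 * R → ‖g z‖ ≤ Real.exp M * ‖g 0‖)
    {z w : ℂ} (him : z.im = w.im) (hre : 0 ≤ z.re) (hle : z.re ≤ w.re)
    (hz : ‖z‖ < R / 8) (hw : ‖w‖ < R / 8) :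
    ‖g z * g (-z)‖ ≤ ‖g w * g (-w)‖ *
      Real.exp (128 * M / R ^ 2 * (‖z‖ ^ 2 + ‖w‖ ^ 2)) := by
  have hfin := finite_zeros_in_closedBall hg ⟨0, h0⟩ R
  obtain ⟨m, E, hE, hES, hgE⟩ := exists_eq_prod_mul_of_entire hg ⟨0, h0⟩ hfin.toFinset
  set S := hfin.toFinset with hS
  have hSmem : ∀ ρ ∈ S, ‖ρ‖ ≤ R ∧ g ρ = 0 := by
    intro ρ hρ
    have := (Set.Finite.mem_toFinset hfin).mp hρ
    exact ⟨by simpa using this.1, this.2⟩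
  have hE0 : E 0 ≠ 0 := by
    intro h
    exact h0 (by rw [hgE, h, mul_zero])
  have hEne : ∀ v ∈ Metric.ball (0 : ℂ) R, E v / E 0 ≠ 0 := by
    intro v hv
    refine div_ne_zero (fun h => ?_) hE0
    have hgv : g v = 0 := by rw [hgE, h, mul_zero]
    exact hES v ((Set.Finite.mem_toFinset hfin).mpr
      ⟨Metric.ball_subset_closedBall hv, hgv⟩) h
  have hEd : Differentiable ℂ (fun v => E v / E 0) := hE.div_const _
  have hsph : ∀ v ∈ frontier (Metric.ball (0 : ℂ) (4 * R)), ‖E v / E 0‖ ≤ Real.exp M := by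
    intro v hv
    have hv' : ‖v‖ = 4 * R := by simpa using Metric.frontier_ball_subset_sphere hv
    have h1 := hbd v hv'
    rw [hgE v, hgE 0, norm_mul, norm_mul, norm_prod, norm_prod] at h1
    have hle : ∏ ρ ∈ S, ‖((0 : ℂ) - ρ) ^ m ρ‖ ≤ ∏ ρ ∈ S, ‖(v - ρ) ^ m ρ‖ := by
      refine Finset.prod_le_prod (fun _ _ => norm_nonneg _) fun ρ hρ => ?_
      rw [norm_pow, norm_pow]
      refine pow_le_pow_left₀ (norm_nonneg _) ?_ _
      have h2 := norm_sub_norm_le v ρ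
      have h3 := (hSmem ρ hρ).1
      rw [zero_sub, norm_neg]
      linarith
    have hpos : 0 < ∏ ρ ∈ S, ‖((0 : ℂ) - ρ) ^ m ρ‖ := by
      have : (∏ ρ ∈ S, ((0 : ℂ) - ρ) ^ m ρ) ≠ 0 := by
        intro h
        exact h0 (by rw [hgE, h, zero_mul])
      rw [← norm_prod]
      exact norm_pos_iff.mpr this
    rw [norm_div, div_le_iff₀ (norm_pos_iff.mpr hE0)]
    have h4 : (∏ ρ ∈ S, ‖((0 : ℂ) - ρ) ^ m ρ‖) * ‖E v‖ ≤
        (∏ ρ ∈ S, ‖((0 : ℂ) - ρ) ^ m ρ‖) * (Real.exp M * ‖E 0‖) :=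
      calc _ ≤ (∏ ρ ∈ S, ‖(v - ρ) ^ m ρ‖) * ‖E v‖ := by gcongr
        _ ≤ _ := h1
        _ = _ := by ring
    exact le_of_mul_le_mul_left h4 hpos
  have hball : ∀ v ∈ Metric.ball (0 : ℂ) R, ‖E v / E 0‖ ≤ Real.exp M := by
    intro v hv
    refine Complex.norm_le_of_forall_mem_frontier_norm_le Metric.isBounded_ball
      hEd.diffContOnCl hsph (subset_closure ?_)
    exact Metric.ball_subset_ball (by linarith) hv
  obtain ⟨l, hl, hl0, hexp⟩ := exists_log_on_ball hR hEd.differentiableOn hEne (div_self hE0)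
  have hre' : ∀ v ∈ Metric.ball (0 : ℂ) R, (l v).re ≤ M := by
    intro v hv
    have := hball v hv
    rwa [← hexp v hv, Complex.norm_exp, Real.exp_le_exp] at this
  have hform : ∀ v : ℂ, ‖v‖ < R / 8 → ‖g v * g (-v)‖ =
      (∏ ρ ∈ S, ‖(v - ρ) * (-v - ρ)‖ ^ m ρ) * (‖E 0‖ ^ 2 * Real.exp (l v + l (-v)).re) := by
    intro v hv
    have hv1 : v ∈ Metric.ball (0 : ℂ) R := by
      simp only [Metric.mem_ball, dist_zero_right]
      linarith
    have hv2 : -v ∈ Metric.ball (0 : ℂ) R := by simpa using hv1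
    have e1 : E v = Complex.exp (l v) * E 0 := by rw [hexp v hv1, div_mul_cancel₀ _ hE0]
    have e2 : E (-v) = Complex.exp (l (-v)) * E 0 := by rw [hexp _ hv2, div_mul_cancel₀ _ hE0]
    have e3 : g v * g (-v) = (∏ ρ ∈ S, ((v - ρ) * (-v - ρ)) ^ m ρ) *
        (E 0 ^ 2 * Complex.exp (l v + l (-v))) := by
      rw [hgE v, hgE (-v), e1, e2, Complex.exp_add]
      simp only [mul_pow, Finset.prod_mul_distrib]
      ring
    rw [e3, norm_mul, norm_mul, norm_prod, norm_pow, Complex.norm_exp]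
    simp only [norm_pow]
  have hqz := norm_add_neg_le_of_re_le hR hM hl hl0 hre' hz
  have hqw := norm_add_neg_le_of_re_le hR hM hl hl0 hre' hw
  have hlez : (l z + l (-z)).re ≤ (l w + l (-w)).re +
      128 * M / R ^ 2 * (‖z‖ ^ 2 + ‖w‖ ^ 2) := by
    have h1 := (Complex.re_le_norm (l z + l (-z))).trans hqz
    have h2 := (Complex.abs_re_le_norm (l w + l (-w))).trans hqw
    have h3 := neg_le_of_abs_le h2
    rw [mul_add]
    linarith
  rw [hform z hz, hform w hw, mul_assoc, mul_assoc, ← Real.exp_add]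
  refine mul_le_mul (Finset.prod_le_prod (fun _ _ => by positivity) fun ρ hρ => ?_) ?_
    (by positivity) (Finset.prod_nonneg fun _ _ => by positivity)
  · exact pow_le_pow_left₀ (norm_nonneg _)
      (norm_sub_mul_neg_sub_mono (hzero ρ (hSmem ρ hρ).2) him hre hle) _
  · gcongr

/-- For an entire function of order less than two with purely imaginary zeros, not vanishing at
the origin, `|g z g (-z)|` increases with `Re z ≥ 0`. -/
lemma norm_mul_neg_mono_of_ne_zero {g : ℂ → ℂ} (hg : Differentiable ℂ g) (h0 : g 0 ≠ 0)
    (hzero : ∀ ρ, g ρ = 0 → ρ.re = 0) {B : ℝ → ℝ}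
    (hB : Tendsto (fun R => B R / R ^ 2) atTop (𝓝 0)) (hbd : ∀ᶠ R in atTop, ∀ z, ‖z‖ = R →
      ‖g z‖ ≤ Real.exp (B R)) {z w : ℂ} (him : z.im = w.im) (hre : 0 ≤ z.re)
    (hle : z.re ≤ w.re) : ‖g z * g (-z)‖ ≤ ‖g w * g (-w)‖ := by
  set c : ℝ := |Real.log ‖g 0‖| + 1 with hc
  have h4 : Tendsto (fun R : ℝ => 4 * R) atTop atTop :=
    tendsto_id.const_mul_atTop (by norm_num)
  have hlim : Tendsto (fun R : ℝ => 128 * (|B (4 * R)| + c) / R ^ 2 * (‖z‖ ^ 2 + ‖w‖ ^ 2))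
      atTop (𝓝 0) := by
    have h1 : Tendsto (fun R : ℝ => |B (4 * R) / (4 * R) ^ 2|) atTop (𝓝 0) := by
      simpa using (hB.comp h4).abs
    have h2 : Tendsto (fun R : ℝ => c / R ^ 2) atTop (𝓝 0) :=
      tendsto_const_nhds.div_atTop (tendsto_pow_atTop (by norm_num))
    have h3 := (((h1.const_mul 16).add h2).const_mul 128).mul_const (‖z‖ ^ 2 + ‖w‖ ^ 2)
    simp only [mul_zero, add_zero, zero_mul] at h3
    refine h3.congr' ?_
    filter_upwards [eventually_gt_atTop 0] with R hR
    rw [abs_div, abs_of_pos (show 0 < (4 * R) ^ 2 by positivity)]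
    field_simp
    ring
  have hlim' : Tendsto (fun R : ℝ => ‖g w * g (-w)‖ *
      Real.exp (128 * (|B (4 * R)| + c) / R ^ 2 * (‖z‖ ^ 2 + ‖w‖ ^ 2))) atTop
      (𝓝 ‖g w * g (-w)‖) := by
    have := ((Real.continuous_exp.tendsto 0).comp hlim).const_mul ‖g w * g (-w)‖
    simpa using this
  refine ge_of_tendsto hlim' ?_
  filter_upwards [h4.eventually hbd, eventually_gt_atTop 0, eventually_gt_atTop (8 * ‖z‖),
    eventually_gt_atTop (8 * ‖w‖)] with R hR hR0 hRz hRw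
  refine norm_mul_neg_le_mul_exp hg h0 hzero hR0 (by positivity) (fun v hv => ?_) him hre hle
    (by linarith) (by linarith)
  refine (hR v hv).trans ?_
  have hg0 : 0 < ‖g 0‖ := norm_pos_iff.mpr h0
  have e : ‖g 0‖ = Real.exp (Real.log ‖g 0‖) := (Real.exp_log hg0).symm
  rw [e, ← Real.exp_add, Real.exp_le_exp]
  have h1 := le_abs_self (B (4 * R))
  have h2 := neg_abs_le (Real.log ‖g 0‖)
  simp only [hc]
  linarith

/-- An even entire function of order less than two with purely imaginary zeros has modulus
increasing with `Re z ≥ 0`. -/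
lemma norm_mono_of_even_of_zeros_imaginary {f : ℂ → ℂ} (hf : Differentiable ℂ f)
    (hne : ∃ z, f z ≠ 0) (heven : ∀ z, f (-z) = f z) (hzero : ∀ ρ, f ρ = 0 → ρ.re = 0)
    {B : ℝ → ℝ} (hB : Tendsto (fun R => B R / R ^ 2) atTop (𝓝 0))
    (hbd : ∀ᶠ R in atTop, ∀ z, ‖z‖ = R → ‖f z‖ ≤ Real.exp (B R)) {z w : ℂ}
    (him : z.im = w.im) (hre : 0 ≤ z.re) (hle : z.re ≤ w.re) : ‖f z‖ ≤ ‖f w‖ := by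
  obtain ⟨k, g, hg, hg0, hfg⟩ := exists_eq_sub_pow_mul_of_entire hf hne 0
  simp only [sub_zero] at hfg
  have hgmono := norm_mul_neg_mono_of_ne_zero hg hg0
    (fun ρ hρ => hzero ρ (by rw [hfg, hρ, mul_zero])) hB (by
      filter_upwards [hbd, eventually_ge_atTop 1] with R hR hR1 v hv
      have h1 := hR v hv
      rw [hfg, norm_mul, norm_pow, hv] at h1
      have h2 : 1 ≤ R ^ k := one_le_pow₀ hR1
      nlinarith [norm_nonneg (g v)]) him hre hle
  have hzw : ‖z‖ ≤ ‖w‖ := by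
    rw [Complex.norm_eq_sqrt_sq_add_sq, Complex.norm_eq_sqrt_sq_add_sq, him]
    apply Real.sqrt_le_sqrt
    nlinarith
  have e : ∀ v, ‖f v‖ ^ 2 = (‖v‖ ^ k) ^ 2 * ‖g v * g (-v)‖ := by
    intro v
    have : ‖f v‖ ^ 2 = ‖f v‖ * ‖f (-v)‖ := by rw [heven, pow_two]
    rw [this, hfg v, hfg (-v)]
    simp only [norm_mul, norm_pow, norm_neg]
    ring
  refine (pow_le_pow_iff_left₀ (norm_nonneg _) (norm_nonneg _) two_ne_zero).mp ?_
  rw [e z, e w]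
  gcongr

/-- The entire function `(1/4 - z²) Λ(1/2 + z)`, a normalisation of Riemann's `ξ`. -/
noncomputable def xi (z : ℂ) : ℂ :=
  (1 / 4 - z ^ 2) * completedRiemannZeta₀ (1 / 2 + z) - 1

lemma differentiable_xi : Differentiable ℂ xi := by
  unfold xi
  exact (((differentiable_const _).sub (differentiable_id.pow 2)).mul
    (differentiable_completedZeta₀.comp ((differentiable_const _).add differentiable_id))).sub_const _

lemma xi_neg (z : ℂ) : xi (-z) = xi z := by
  unfold xi
  rw [← completedRiemannZeta₀_one_sub (1 / 2 + z)]
  ring_nf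

lemma xi_half : xi (1 / 2) = -1 := by
  unfold xi; norm_num

lemma xi_eq_completedRiemannZeta {z : ℂ} (h1 : z ≠ 1 / 2) (h2 : z ≠ -(1 / 2)) :
    xi z = (1 / 4 - z ^ 2) * completedRiemannZeta (1 / 2 + z) := by
  have h3 : 1 / 2 + z ≠ 0 := fun h => h2 (by linear_combination h)
  have h4 : 1 - (1 / 2 + z) ≠ 0 := fun h => h1 (by linear_combination -h)
  have e : 1 / 4 - z ^ 2 = (1 / 2 + z) * (1 - (1 / 2 + z)) := by ring
  rw [completedRiemannZeta_eq]
  unfold xi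
  rw [e]
  generalize 1 / 2 + z = s at *
  field_simp
  ring

lemma xi_eq_Gammaℝ_mul_riemannZeta {z : ℂ} (h1 : z ≠ 1 / 2) (h2 : z ≠ -(1 / 2))
    (h3 : Complex.Gammaℝ (1 / 2 + z) ≠ 0) :
    xi z = (1 / 4 - z ^ 2) * (Complex.Gammaℝ (1 / 2 + z) * riemannZeta (1 / 2 + z)) := by
  rw [xi_eq_completedRiemannZeta h1 h2,
    riemannZeta_def_of_ne_zero (fun h => h2 (by linear_combination h)), mul_div_cancel₀ _ h3]

lemma Complex.norm_Gamma_le {s : ℂ} (hs : 0 < s.re) :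
    ‖Complex.Gamma s‖ ≤ Real.Gamma s.re := by
  rw [Complex.Gamma_eq_integral hs, Real.Gamma_eq_integral hs, Complex.GammaIntegral]
  refine (MeasureTheory.norm_integral_le_integral_norm _).trans (le_of_eq ?_)
  refine MeasureTheory.setIntegral_congr_fun measurableSet_Ioi fun x hx => ?_
  have hx' : (0 : ℝ) < x := hx
  have e : ‖Complex.exp (-(x : ℂ))‖ = Real.exp (-x) := by rw [Complex.norm_exp]; simp
  simp [Complex.norm_cpow_eq_rpow_re_of_pos hx', e]

lemma Real.Gamma_le_rpow {x : ℝ} (hx : 1 ≤ x) : Real.Gamma x ≤ (x + 2) ^ (x + 2) := by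
  have hx0 : 0 < x := by linarith
  have h1 : Real.Gamma x ≤ Real.Gamma (x + 1) := by
    rw [Real.Gamma_add_one hx0.ne']
    have := Real.Gamma_pos_of_pos hx0
    nlinarith
  have hc := Nat.le_ceil x
  have hc2 := Nat.ceil_lt_add_one hx0.le
  have h2 : Real.Gamma (x + 1) ≤ Real.Gamma (⌈x⌉₊ + 1) :=
    Real.Gamma_strictMonoOn_Ici.monotoneOn (by simp; linarith)
      (by simp only [Set.mem_Ici]; linarith) (by linarith)
  rw [Real.Gamma_nat_eq_factorial] at h2
  have h3 : ((Nat.factorial ⌈x⌉₊ : ℕ) : ℝ) ≤ (⌈x⌉₊ : ℝ) ^ (⌈x⌉₊ : ℕ) := by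
    exact_mod_cast Nat.factorial_le_pow _
  calc _ ≤ (⌈x⌉₊ : ℝ) ^ (⌈x⌉₊ : ℕ) := h1.trans (h2.trans h3)
    _ ≤ (x + 2) ^ (⌈x⌉₊ : ℕ) := by gcongr; linarith
    _ = (x + 2) ^ (⌈x⌉₊ : ℝ) := (Real.rpow_natCast _ _).symm
    _ ≤ _ := Real.rpow_le_rpow_of_exponent_le (by linarith) (by linarith)

lemma norm_riemannZeta_le_of_two_le_re :
    ∃ C, 0 < C ∧ ∀ s : ℂ, 2 ≤ s.re → ‖riemannZeta s‖ ≤ C := by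
  have hsum : Summable fun n : ℕ => 1 / (n : ℝ) ^ (2 : ℝ) :=
    Real.summable_one_div_nat_rpow.mpr (by norm_num)
  refine ⟨∑' n : ℕ, 1 / (n : ℝ) ^ (2 : ℝ), hsum.tsum_pos (fun n => by positivity) 1 (by simp),
    fun s hs => ?_⟩
  rw [zeta_eq_tsum_one_div_nat_cpow (by linarith)]
  refine tsum_of_norm_bounded hsum.hasSum fun n => ?_
  rcases Nat.eq_zero_or_pos n with rfl | hn
  · rw [Nat.cast_zero, Complex.zero_cpow (fun h => by norm_num [h] at hs)]
    simp
  · rw [norm_div, norm_one, Complex.norm_natCast_cpow_of_pos hn]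
    have : (1 : ℝ) ≤ n := by exact_mod_cast hn
    gcongr

lemma norm_completedRiemannZeta₀_le_strip :
    ∃ C, 0 < C ∧ ∀ s : ℂ, 1 / 2 ≤ s.re → s.re ≤ 2 → ‖completedRiemannZeta₀ s‖ ≤ C := by
  set P := HurwitzZeta.hurwitzEvenFEPair 0
  set F : ℝ → ℝ → ℝ := fun x t => ‖(t : ℂ) ^ ((x : ℂ) - 1) • P.f_modif t‖
  have hInt (x : ℝ) : MeasureTheory.IntegrableOn (F x) (Set.Ioi 0) :=
    MeasureTheory.Integrable.norm (P.isStrongFEPair_toStrongFEPair.hasMellin (x : ℂ)).1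
  refine ⟨(∫ t in Set.Ioi (0 : ℝ), (F (1 / 4) t + F 1 t)) + 1, ?_, fun s h1 h2 => ?_⟩
  · have : 0 ≤ ∫ t in Set.Ioi (0 : ℝ), (F (1 / 4) t + F 1 t) :=
      MeasureTheory.integral_nonneg fun t => add_nonneg (norm_nonneg _) (norm_nonneg _)
    linarith
  · have e : completedRiemannZeta₀ s = mellin P.f_modif (s / 2) / 2 := rfl
    have hm : ‖mellin P.f_modif (s / 2)‖ ≤ ∫ t in Set.Ioi (0 : ℝ), (F (1 / 4) t + F 1 t) := by
      refine MeasureTheory.norm_integral_le_of_norm_le ((hInt _).add (hInt _)) ?_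
      refine (MeasureTheory.ae_restrict_iff' measurableSet_Ioi).mpr (Eventually.of_forall ?_)
      intro t ht
      have ht' : (0 : ℝ) < t := ht
      simp only [F, norm_smul, Complex.norm_cpow_eq_rpow_re_of_pos ht', ← add_mul]
      refine mul_le_mul_of_nonneg_right ?_ (norm_nonneg _)
      have e1 : (s / 2 - 1).re = s.re / 2 - 1 := by simp
      have e2 : (((1 / 4 : ℝ) : ℂ) - 1).re = 1 / 4 - 1 := by simp
      have e3 : (((1 : ℝ) : ℂ) - 1).re = 1 - 1 := by simp
      rw [e1, e2, e3]
      rcases le_total t 1 with h | h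
      · exact le_add_of_le_of_nonneg (Real.rpow_le_rpow_of_exponent_ge ht' h (by linarith))
          (Real.rpow_nonneg ht'.le _)
      · exact le_add_of_nonneg_of_le (Real.rpow_nonneg ht'.le _)
          (Real.rpow_le_rpow_of_exponent_le h (by linarith))
    rw [e, norm_div, Complex.norm_two]
    have := norm_nonneg (mellin P.f_modif (s / 2))
    linarith

lemma norm_quarter_sub_sq_le (z : ℂ) : ‖1 / 4 - z ^ 2‖ ≤ 1 + ‖z‖ ^ 2 := by
  refine (norm_sub_le _ _).trans ?_
  rw [norm_pow]
  gcongr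
  norm_num

lemma norm_xi_le : ∃ K, 0 < K ∧ ∀ z : ℂ, ‖xi z‖ ≤ K * (‖z‖ + 5) ^ (2 * (‖z‖ + 5)) := by
  obtain ⟨C1, hC1, h1⟩ := norm_completedRiemannZeta₀_le_strip
  obtain ⟨C2, hC2, h2⟩ := norm_riemannZeta_le_of_two_le_re
  refine ⟨C1 + C2 + 1, by positivity, ?_⟩
  suffices H : ∀ z : ℂ, 0 ≤ z.re → ‖xi z‖ ≤ (C1 + C2 + 1) * (‖z‖ + 5) ^ (2 * (‖z‖ + 5)) by
    intro z
    rcases le_total 0 z.re with h | h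
    · exact H z h
    · have := H (-z) (by simpa using h)
      rwa [xi_neg, norm_neg] at this
  intro z hz
  have hq := norm_quarter_sub_sq_le z
  set R := ‖z‖ with hR
  have hR0 : 0 ≤ R := norm_nonneg z
  have hX : (1 : ℝ) ≤ R + 5 := by linarith
  have hX2 : 1 + R ^ 2 ≤ (R + 5) ^ (2 : ℝ) := by
    rw [Real.rpow_two]; nlinarith
  have hXX : (R + 5) ^ (2 : ℝ) ≤ (R + 5) ^ (2 * (R + 5)) :=
    Real.rpow_le_rpow_of_exponent_le hX (by linarith)
  have hX1 : 1 ≤ (R + 5) ^ (2 * (R + 5)) := Real.one_le_rpow hX (by linarith)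
  have hre : (1 / 2 + z).re = 1 / 2 + z.re := by simp
  rcases le_total z.re (3 / 2) with h | h
  · have h3 := h1 (1 / 2 + z) (by rw [hre]; linarith) (by rw [hre]; linarith)
    calc ‖xi z‖ ≤ ‖1 / 4 - z ^ 2‖ * ‖completedRiemannZeta₀ (1 / 2 + z)‖ + 1 := by
          unfold xi
          refine (norm_sub_le _ _).trans (by rw [norm_mul, norm_one])
      _ ≤ (R + 5) ^ (2 * (R + 5)) * C1 + 1 := by
          gcongr
          exact hq.trans (hX2.trans hXX)
      _ ≤ _ := by
          generalize (R + 5) ^ (2 * (R + 5)) = Y at hX1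
          nlinarith
  · have hn1 : z ≠ 1 / 2 := fun h' => by rw [h'] at h; norm_num at h
    have hn2 : z ≠ -(1 / 2) := fun h' => by rw [h'] at h; norm_num at h
    have hG : Complex.Gammaℝ (1 / 2 + z) ≠ 0 :=
      Complex.Gammaℝ_ne_zero_of_re_pos (by rw [hre]; linarith)
    have hre2 : ((1 / 2 + z) / 2).re = (1 / 2 + z.re) / 2 := by simp
    have hzR : z.re ≤ R := Complex.re_le_norm z
    have hG2 : ‖Complex.Gammaℝ (1 / 2 + z)‖ ≤ (R + 5) ^ (R + 5) := by
      rw [Complex.Gammaℝ_def, norm_mul]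
      have a1 : ‖(Real.pi : ℂ) ^ (-(1 / 2 + z) / 2)‖ ≤ 1 := by
        rw [Complex.norm_cpow_eq_rpow_re_of_pos Real.pi_pos]
        refine Real.rpow_le_one_of_one_le_of_nonpos (by linarith [Real.pi_gt_three]) ?_
        rw [neg_div, Complex.neg_re, hre2]; linarith
      have a2 := Complex.norm_Gamma_le (s := (1 / 2 + z) / 2) (by rw [hre2]; linarith)
      rw [hre2] at a2
      have a3 := Real.Gamma_le_rpow (x := (1 / 2 + z.re) / 2) (by linarith)
      have a4 : ((1 / 2 + z.re) / 2 + 2) ^ ((1 / 2 + z.re) / 2 + 2) ≤ (R + 5) ^ (R + 5) :=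
        (Real.rpow_le_rpow (by linarith) (by linarith) (by linarith)).trans
          (Real.rpow_le_rpow_of_exponent_le hX (by linarith))
      calc _ ≤ 1 * (R + 5) ^ (R + 5) :=
            mul_le_mul a1 (a2.trans (a3.trans a4)) (norm_nonneg _) zero_le_one
        _ = _ := one_mul _
    have h3 := h2 (1 / 2 + z) (by rw [hre]; linarith)
    rw [xi_eq_Gammaℝ_mul_riemannZeta hn1 hn2 hG, norm_mul, norm_mul]
    calc _ ≤ (R + 5) ^ (2 : ℝ) * ((R + 5) ^ (R + 5) * C2) := by gcongr; exact hq.trans hX2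
      _ = C2 * (R + 5) ^ (2 + (R + 5)) := by rw [Real.rpow_add (by linarith) 2]; ac_rfl
      _ ≤ C2 * (R + 5) ^ (2 * (R + 5)) := by gcongr; linarith
      _ ≤ _ := by
          generalize (R + 5) ^ (2 * (R + 5)) = Y at hX1
          nlinarith

lemma xi_eq_zero_re (RH : RiemannHypothesis) {ρ : ℂ} (h : xi ρ = 0) : ρ.re = 0 := by
  suffices H : ∀ ρ : ℂ, xi ρ = 0 → 0 ≤ ρ.re → ρ.re = 0 by
    rcases le_total 0 ρ.re with h0 | h0
    · exact H ρ h h0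
    · have := H (-ρ) (by rwa [xi_neg]) (by simpa using h0)
      simpa using this
  intro ρ h h0
  have hre : (1 / 2 + ρ).re = 1 / 2 + ρ.re := by simp
  have hn1 : ρ ≠ 1 / 2 := fun h' => by rw [h', xi_half] at h; norm_num at h
  have hn2 : ρ ≠ -(1 / 2) := fun h' => by rw [h', xi_neg, xi_half] at h; norm_num at h
  have hG : Complex.Gammaℝ (1 / 2 + ρ) ≠ 0 :=
    Complex.Gammaℝ_ne_zero_of_re_pos (by rw [hre]; linarith)
  rw [xi_eq_Gammaℝ_mul_riemannZeta hn1 hn2 hG] at h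
  have h3 : 1 / 4 - ρ ^ 2 ≠ 0 := by
    rw [show 1 / 4 - ρ ^ 2 = (1 / 2 - ρ) * (ρ - -(1 / 2)) by ring]
    exact mul_ne_zero (sub_ne_zero.mpr hn1.symm) (sub_ne_zero.mpr hn2)
  have hz : riemannZeta (1 / 2 + ρ) = 0 := by
    exact ((mul_eq_zero.mp ((mul_eq_zero.mp h).resolve_left h3))).resolve_left hG
  have := RH (1 / 2 + ρ) hz ?_ (fun h' => hn1 (by linear_combination h'))
  · rw [hre] at this; linarith
  · rintro ⟨n, hn⟩
    have := congrArg Complex.re hn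
    rw [hre] at this
    simp at this
    have hn0 : (0 : ℝ) ≤ n := Nat.cast_nonneg n
    linarith

lemma norm_xi_mono (RH : RiemannHypothesis) {z w : ℂ} (him : z.im = w.im) (h0 : 0 ≤ z.re)
    (hle : z.re ≤ w.re) : ‖xi z‖ ≤ ‖xi w‖ := by
  obtain ⟨K, hK, hb⟩ := norm_xi_le
  refine norm_mono_of_even_of_zeros_imaginary (B := fun R => Real.log K + 2 * (R + 5) *
    Real.log (R + 5)) differentiable_xi ⟨1 / 2, by rw [xi_half]; norm_num⟩ xi_neg
    (fun ρ => xi_eq_zero_re RH) ?_ ?_ him h0 hle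
  · have t1 : Tendsto (fun R : ℝ => Real.log K / R ^ 2) atTop (𝓝 0) :=
      tendsto_const_nhds.div_atTop (tendsto_pow_atTop (by norm_num))
    have t2 : Tendsto (fun R : ℝ => Real.log R / R) atTop (𝓝 0) :=
      Real.isLittleO_log_id_atTop.tendsto_div_nhds_zero
    have t3 : Tendsto (fun R : ℝ => R + 5) atTop atTop := tendsto_atTop_add_const_right _ _ tendsto_id
    have t4 := t2.comp t3
    have t5 : Tendsto (fun R : ℝ => 5 / R) atTop (𝓝 0) := tendsto_const_nhds.div_atTop tendsto_id
    have t6 := t1.add ((t4.mul ((t5.const_add 1).pow 2)).const_mul 2)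
    simp only [mul_zero, add_zero, zero_mul] at t6
    refine t6.congr' ?_
    filter_upwards [eventually_gt_atTop 0] with R hR
    simp only [Function.comp]
    field_simp
  · refine Eventually.of_forall fun R z hz => ?_
    have hR : 0 ≤ R := hz ▸ norm_nonneg z
    refine (hb z).trans (le_of_eq ?_)
    rw [hz, Real.exp_add, Real.exp_log hK, Real.rpow_def_of_pos (by linarith)]
    ring_nf

lemma completedRiemannZeta₀_conj (s : ℂ) :
    completedRiemannZeta₀ (starRingEnd ℂ s) = starRingEnd ℂ (completedRiemannZeta₀ s) := by
  set P := HurwitzZeta.hurwitzEvenFEPair 0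
  have e (s : ℂ) : completedRiemannZeta₀ s = mellin P.f_modif (s / 2) / 2 := rfl
  have hreal (t : ℝ) : starRingEnd ℂ (P.f_modif t) = P.f_modif t := by
    have h1 : P.ε = 1 := rfl
    have h2 : P.g₀ = 1 := rfl
    have h3 : P.f₀ = 1 := if_pos rfl
    have h4 : P.f t = (HurwitzZeta.evenKernel 0 t : ℂ) := rfl
    simp only [WeakFEPair.f_modif, Pi.add_apply, Set.indicator_apply, map_add, apply_ite (starRingEnd ℂ),
      h1, h2, h3, h4, map_sub, Complex.conj_ofReal, map_one, map_zero, smul_eq_mul, map_mul]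
  rw [e, e, map_div₀, Complex.conj_ofNat]
  congr 1
  rw [mellin, mellin, ← integral_conj]
  refine MeasureTheory.setIntegral_congr_fun measurableSet_Ioi fun t ht => ?_
  have ht' : (0 : ℝ) < t := ht
  simp only [smul_eq_mul, map_mul, hreal]
  congr 1
  have := Complex.cpow_conj (t : ℂ) (s / 2 - 1)
    (by rw [Complex.arg_ofReal_of_nonneg ht'.le]; exact Real.pi_pos.ne)
  simpa [Complex.conj_ofNat] using this

lemma xi_conj (z : ℂ) : xi (starRingEnd ℂ z) = starRingEnd ℂ (xi z) := by
  have h := completedRiemannZeta₀_conj (1 / 2 + z)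
  simp only [map_add, map_div₀, map_one, Complex.conj_ofNat] at h
  simp only [xi, map_sub, map_mul, map_pow, map_div₀, map_one, Complex.conj_ofNat, h]

lemma xi_ne_zero_of_re_pos (RH : RiemannHypothesis) {z : ℂ} (hz : 0 < z.re) : xi z ≠ 0 :=
  fun h => hz.ne' (xi_eq_zero_re RH h)

lemma hasDerivAt_normSq_comp_horizontal {f : ℂ → ℂ} {z : ℂ} (hf : DifferentiableAt ℂ f z) :
    HasDerivAt (fun x : ℝ => Complex.normSq (f (x + z.im * Complex.I)))
      (2 * (starRingEnd ℂ (f z) * deriv f z).re) z.re := by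
  have e : ((z.re : ℂ) + z.im * Complex.I) = z := Complex.re_add_im z
  have h1 : HasDerivAt (fun x : ℝ => f (x + z.im * Complex.I)) (deriv f z) z.re := by
    have h2 : HasDerivAt f (deriv f z) ((z.re : ℂ) + z.im * Complex.I) := by
      rw [e]; exact hf.hasDerivAt
    have h3 : HasDerivAt (fun w : ℂ => w + z.im * Complex.I) 1 (z.re : ℂ) :=
      (hasDerivAt_id _).add_const _
    simpa using (HasDerivAt.comp (z.re : ℂ) h2 h3).comp_ofReal
  have hre : HasDerivAt (fun x : ℝ => (f (x + z.im * Complex.I)).re) (deriv f z).re z.re :=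
    Complex.reCLM.hasFDerivAt.comp_hasDerivAt _ h1
  have him : HasDerivAt (fun x : ℝ => (f (x + z.im * Complex.I)).im) (deriv f z).im z.re :=
    Complex.imCLM.hasFDerivAt.comp_hasDerivAt _ h1
  have := (hre.mul hre).add (him.mul him)
  rw [e] at this
  refine this.congr_deriv ?_
  rw [Complex.mul_re, Complex.conj_re, Complex.conj_im]
  ring

lemma logDeriv_eq_conj_mul_div_normSq (f : ℂ → ℂ) (z : ℂ) :
    (logDeriv f z).re = (starRingEnd ℂ (f z) * deriv f z).re / Complex.normSq (f z) := by
  rw [logDeriv_apply, Complex.div_re, Complex.mul_re, Complex.conj_re, Complex.conj_im]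
  ring

lemma re_logDeriv_xi_nonneg (RH : RiemannHypothesis) {z : ℂ} (hz : 0 < z.re) :
    0 ≤ (logDeriv xi z).re := by
  rw [logDeriv_eq_conj_mul_div_normSq]
  refine div_nonneg ?_ (Complex.normSq_nonneg _)
  have hd := hasDerivAt_normSq_comp_horizontal (differentiable_xi z)
  have : 0 ≤ 2 * (starRingEnd ℂ (xi z) * deriv xi z).re := by
    refine hd.hasDerivWithinAt.nonneg_of_monotoneOn (s := Set.Ioi 0) ?_ ?_
    · exact (uniqueDiffWithinAt_iff_accPt.mp (isOpen_Ioi.uniqueDiffWithinAt hz))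
    · intro a ha b hb hab
      simp only [Complex.normSq_eq_norm_sq]
      have ha' : (0 : ℝ) < a := ha
      have := norm_xi_mono RH (z := a + z.im * Complex.I) (w := b + z.im * Complex.I)
        (by simp) (by simp [ha'.le]) (by simpa using hab)
      gcongr
  linarith

lemma re_logDeriv_xi_of_re_eq_zero {z : ℂ} (hz : z.re = 0) : (logDeriv xi z).re = 0 := by
  have hc : starRingEnd ℂ z = -z := by
    apply Complex.ext <;> simp [hz]
  have h1 : starRingEnd ℂ (xi z) = xi z := by rw [← xi_conj, hc, xi_neg]
  have h2 : deriv xi (-z) = - deriv xi z := by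
    have := deriv_comp_neg xi z
    simp only [xi_neg] at this
    rw [this, neg_neg]
  have h3 : starRingEnd ℂ (deriv xi z) = deriv xi (-z) := by
    have h4 : (starRingEnd ℂ ∘ xi ∘ starRingEnd ℂ) = xi := by
      funext w
      simp [xi_conj]
    have := congrFun (deriv_conj_conj (f := xi)) (-z)
    rw [h4] at this
    rw [this]
    simp [← hc]
  have h5 : (deriv xi z).re = 0 := by
    have := congrArg Complex.re (h3.trans h2)
    simp at this
    linarith
  have h6 : (xi z).im = 0 := Complex.conj_eq_iff_im.mp h1
  rw [logDeriv_eq_conj_mul_div_normSq]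
  simp [Complex.mul_re, h5, h6]

lemma Complex.Gamma_add_natCast {s : ℂ} (hs : 0 < s.re) (n : ℕ) :
    Complex.Gamma (s + n) = Complex.Gamma s * ∏ j ∈ Finset.range n, (s + j) := by
  induction n with
  | zero => simp
  | succ n ih =>
    have h : s + n ≠ 0 := fun h => by
      have h0 : (0 : ℝ) ≤ n := n.cast_nonneg
      have := congrArg Complex.re h
      simp at this
      linarith
    rw [Finset.prod_range_succ, Nat.cast_succ, ← add_assoc, Complex.Gamma_add_one _ h, ih]
    ring

lemma Real.Gamma_natCast_add_le {n : ℕ} (hn : 1 ≤ n) {x : ℝ} (h0 : 0 < x) (h2 : x < 2) :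
    Real.Gamma (n + 1 + x) ≤ 6 * (n : ℝ) ^ x * n.factorial := by
  have hn' : (1 : ℝ) ≤ n := by exact_mod_cast hn
  have hf : (0 : ℝ) < n.factorial := by exact_mod_cast n.factorial_pos
  have h := Real.Gamma_mul_add_mul_le_rpow_Gamma_mul_rpow_Gamma (s := n + 1) (t := n + 3)
    (a := 1 - x / 2) (b := x / 2) (by positivity) (by positivity) (by linarith) (by linarith)
    (by ring)
  have e : (1 - x / 2) * ((n : ℝ) + 1) + x / 2 * (n + 3) = n + 1 + x := by ring
  have e3 : Real.Gamma ((n : ℝ) + 3) = ((n + 1) * (n + 2)) * n.factorial := by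
    rw [show (n : ℝ) + 3 = (n : ℝ) + 1 + 1 + 1 by ring, Real.Gamma_add_one (by positivity),
      Real.Gamma_add_one (by positivity), Real.Gamma_nat_eq_factorial]
    ring
  rw [e, e3, Real.Gamma_nat_eq_factorial, Real.mul_rpow (by positivity) hf.le, mul_left_comm,
    ← Real.rpow_add hf, sub_add_cancel, Real.rpow_one] at h
  refine h.trans (mul_le_mul_of_nonneg_right ?_ hf.le)
  calc (((n : ℝ) + 1) * (n + 2)) ^ (x / 2) ≤ (6 * (n : ℝ) ^ 2) ^ (x / 2) := by
        refine Real.rpow_le_rpow (by positivity) ?_ (by linarith)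
        nlinarith
    _ = 6 ^ (x / 2) * (n : ℝ) ^ x := by
        rw [Real.mul_rpow (by norm_num) (by positivity), ← Real.rpow_two,
          ← Real.rpow_mul (by positivity)]
        congr 2
        ring
    _ ≤ 6 ^ (1 : ℝ) * (n : ℝ) ^ x := by
        gcongr
        · norm_num
        · linarith
    _ = 6 * (n : ℝ) ^ x := by rw [Real.rpow_one]

lemma eventually_norm_digamma_add_sub_log_le {s : ℂ} (hs : s.re = 1) :
    ∀ᶠ n : ℕ in atTop, ‖Complex.digamma (s + (n + 1 : ℕ)) - Complex.log n‖ ≤ 24 := by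
  set h : ℕ → ℂ → ℂ := fun n w =>
    Complex.Gamma (w + (n + 1 : ℕ)) * Complex.exp (-(Complex.log n * w)) / n.factorial with hh
  have hexp {n : ℕ} (hn : 1 ≤ n) (w : ℂ) :
      Complex.exp (-(Complex.log n * w)) = ((n : ℂ) ^ w)⁻¹ := by
    rw [Complex.exp_neg, Complex.cpow_def_of_ne_zero (by exact_mod_cast (by omega : n ≠ 0))]
  have hlim : Tendsto (fun n => h n s) atTop (𝓝 1) := by
    have hG : Complex.Gamma s ≠ 0 := Complex.Gamma_ne_zero_of_re_pos (by linarith)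
    have h1 := (tendsto_const_nhds (x := Complex.Gamma s)).div
      (Complex.GammaSeq_tendsto_Gamma s) hG
    rw [div_self hG] at h1
    refine h1.congr' ?_
    filter_upwards [eventually_ge_atTop 1] with n hn
    simp only [hh, Pi.div_apply]
    rw [hexp hn, Complex.Gamma_add_natCast (by linarith), Complex.GammaSeq]
    rw [div_div_eq_mul_div, div_mul_eq_div_div]
    ring
  have hhalf : ∀ᶠ n in atTop, (1 / 2 : ℝ) < ‖h n s‖ := by
    have := hlim.norm
    rw [norm_one] at this
    exact this.eventually_const_lt (by norm_num)
  filter_upwards [hhalf, eventually_ge_atTop 1] with n hn1 hn2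
  have hfac : (n.factorial : ℂ) ≠ 0 := by exact_mod_cast n.factorial_ne_zero
  have hGd {w : ℂ} (hw : 0 < w.re) : DifferentiableAt ℂ Complex.Gamma (w + (n + 1 : ℕ)) := by
    refine Complex.differentiableAt_Gamma _ fun m hm => ?_
    have := congrArg Complex.re hm
    simp at this
    have h0 : (0 : ℝ) ≤ n := n.cast_nonneg
    have h1 : (0 : ℝ) ≤ m := m.cast_nonneg
    linarith
  have hhd {w : ℂ} (hw : 0 < w.re) : DifferentiableAt ℂ (h n) w := by
    have h1 : DifferentiableAt ℂ (fun w : ℂ => Complex.Gamma (w + (n + 1 : ℕ))) w :=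
      (hGd hw).comp w (differentiableAt_id.add_const _)
    exact (h1.mul (by fun_prop)).div_const _
  have hre {w : ℂ} (hw : w ∈ Metric.closedBall s (1 / 2)) : 1 / 2 ≤ w.re ∧ w.re ≤ 3 / 2 := by
    have h1 := (Complex.abs_re_le_norm (w - s)).trans (mem_closedBall_iff_norm.mp hw)
    rw [Complex.sub_re, hs, abs_le] at h1
    constructor <;> linarith
  have hbd : ‖deriv (h n) s‖ ≤ 6 / (1 / 2) := by
    refine Complex.norm_deriv_le_of_forall_mem_sphere_norm_le (by norm_num) ?_ ?_
    · refine DifferentiableOn.diffContOnCl fun w hw => ?_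
      rw [closure_ball _ (by norm_num)] at hw
      exact (hhd (by linarith [(hre hw).1])).differentiableWithinAt
    · intro w hw
      obtain ⟨h1, h2⟩ := hre (Metric.sphere_subset_closedBall hw)
      have h3 := Complex.norm_Gamma_le (s := w + (n + 1 : ℕ)) (by simp; positivity)
      have e : (w + (n + 1 : ℕ)).re = n + 1 + w.re := by simp; ring
      rw [e] at h3
      have h4 := Real.Gamma_natCast_add_le hn2 (x := w.re) (by linarith) (by linarith)
      have hnp : (0 : ℝ) < (n : ℝ) ^ w.re := Real.rpow_pos_of_pos (by exact_mod_cast hn2) _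
      have hfp : (0 : ℝ) < n.factorial := by exact_mod_cast n.factorial_pos
      simp only [hh]
      rw [hexp hn2, norm_div, norm_mul, norm_inv, Complex.norm_natCast_cpow_of_pos hn2,
        Complex.norm_natCast, div_le_iff₀ hfp, ← div_eq_mul_inv, div_le_iff₀ hnp]
      linarith
  have hld : logDeriv (h n) s = Complex.digamma (s + (n + 1 : ℕ)) - Complex.log n := by
    have hG1 : Complex.Gamma (s + (n + 1 : ℕ)) ≠ 0 :=
      Complex.Gamma_ne_zero_of_re_pos (by simp [hs]; positivity)
    have d1 : HasDerivAt (fun w : ℂ => Complex.Gamma (w + (n + 1 : ℕ)))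
        (deriv Complex.Gamma (s + (n + 1 : ℕ))) s :=
      (hGd (by linarith)).hasDerivAt.comp_add_const _ _
    have d2 : HasDerivAt (fun w : ℂ => Complex.exp (-(Complex.log n * w)))
        (Complex.exp (-(Complex.log n * s)) * (-(Complex.log n * 1))) s :=
      (((hasDerivAt_id s).const_mul _).neg).cexp
    have d3 : HasDerivAt (h n) _ s := (d1.mul d2).div_const _
    rw [logDeriv_apply, d3.deriv, Complex.digamma_def, logDeriv_apply]
    simp only [hh]
    have := Complex.exp_ne_zero (-(Complex.log n * s))
    field_simp
    ring
  rw [← hld, logDeriv_apply, norm_div, div_le_iff₀ (by linarith)]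
  linarith

lemma norm_log_add_one_sub_log_sub_inv_le {a : ℂ} (ha : 0 < a.re) :
    ‖Complex.log (a + 1) - Complex.log a - a⁻¹‖ ≤ 1 / ‖a‖ ^ 2 := by
  have ha0 : a ≠ 0 := fun h => by simp [h] at ha
  have hsl {t : ℝ} (ht : 0 ≤ t) : a + t ∈ Complex.slitPlane :=
    Or.inl (by simp; linarith)
  have hd : ∀ t ∈ Set.Icc (0 : ℝ) 1, HasDerivWithinAt
      (fun t : ℝ => Complex.log (a + t) - t * a⁻¹) ((a + t)⁻¹ - a⁻¹) (Set.Icc 0 1) t := by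
    intro t ht
    have h1 : HasDerivAt (fun t : ℝ => a + (t : ℂ)) 1 t :=
      (Complex.ofRealCLM.hasDerivAt (x := t)).const_add a
    have h2 := h1.clog_real (hsl ht.1)
    have h3 : HasDerivAt (fun t : ℝ => (t : ℂ) * a⁻¹) (1 * a⁻¹) t :=
      (Complex.ofRealCLM.hasDerivAt (x := t)).mul_const _
    have := (h2.sub h3).hasDerivWithinAt (s := Set.Icc 0 1)
    exact this.congr_deriv (by simp)
  have := norm_image_sub_le_of_norm_deriv_le_segment_01' (C := 1 / ‖a‖ ^ 2) hd ?_
  · simp at this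
    rw [show Complex.log (a + 1) - Complex.log a - a⁻¹ =
      Complex.log (a + 1) - a⁻¹ - Complex.log a by ring]
    simpa using this
  · intro t ht
    have h0 : a + t ≠ 0 := Complex.slitPlane_ne_zero (hsl ht.1)
    have e : (a + t)⁻¹ - a⁻¹ = -t / ((a + t) * a) := by field_simp; ring
    have hn : ‖a‖ ≤ ‖a + t‖ := by
      rw [← sq_le_sq₀ (norm_nonneg _) (norm_nonneg _), ← Complex.normSq_eq_norm_sq,
        ← Complex.normSq_eq_norm_sq, Complex.normSq_apply, Complex.normSq_apply]
      simp
      nlinarith [ht.1]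
    have hp := norm_pos_iff.mpr ha0
    rw [e, norm_div, norm_mul, norm_neg, Complex.norm_real, Real.norm_of_nonneg ht.1, sq]
    gcongr
    exact ht.2.le

lemma norm_digamma_sub_log_le :
    ∃ C, ∀ s : ℂ, s.re = 1 → ‖Complex.digamma s - Complex.log s‖ ≤ C := by
  have hsum : Summable fun k : ℕ => 1 / ((k : ℝ) + 1) ^ 2 := by
    exact_mod_cast (summable_nat_add_iff 1).mpr (Real.summable_one_div_nat_pow.mpr one_lt_two)
  refine ⟨25 + ∑' k : ℕ, 1 / ((k : ℝ) + 1) ^ 2, fun s hs => ?_⟩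
  have hpos (k : ℕ) : 0 < (s + k).re := by simp [hs]; positivity
  have step (k : ℕ) : ‖(Complex.digamma (s + (k + 1 : ℕ)) - Complex.log (s + (k + 1 : ℕ))) -
      (Complex.digamma (s + k) - Complex.log (s + k))‖ ≤ 1 / ((k : ℝ) + 1) ^ 2 := by
    have h1 := Complex.digamma_apply_add_one (s + k) fun m hm => by
      have := hpos k
      rw [hm] at this
      simp at this
      have h1 : (0 : ℝ) ≤ m := m.cast_nonneg
      linarith
    have h2 := norm_log_add_one_sub_log_sub_inv_le (hpos k)
    have h3 : (k : ℝ) + 1 ≤ ‖s + k‖ := by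
      refine le_trans (le_of_eq ?_) (Complex.re_le_norm _)
      simp [hs]; ring
    rw [Nat.cast_succ, ← add_assoc, h1, ← norm_neg]
    rw [show -(Complex.digamma (s + k) + (s + k)⁻¹ - Complex.log (s + k + 1) -
      (Complex.digamma (s + k) - Complex.log (s + k))) =
      Complex.log (s + k + 1) - Complex.log (s + k) - (s + k)⁻¹ by ring]
    refine h2.trans ?_
    gcongr
  have tele (n : ℕ) : ‖Complex.digamma s - Complex.log s‖ ≤
      ‖Complex.digamma (s + n) - Complex.log (s + n)‖ + ∑ k ∈ Finset.range n,
        1 / ((k : ℝ) + 1) ^ 2 := by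
    have h1 := Finset.sum_range_sub
      (fun k : ℕ => Complex.digamma (s + k) - Complex.log (s + k)) n
    have h2 := (norm_sum_le (Finset.range n) (fun k : ℕ =>
      (Complex.digamma (s + (k + 1 : ℕ)) - Complex.log (s + (k + 1 : ℕ))) -
      (Complex.digamma (s + k) - Complex.log (s + k)))).trans
      (Finset.sum_le_sum fun k _ => step k)
    rw [h1, Nat.cast_zero, add_zero] at h2
    have h3 := norm_sub_norm_le (Complex.digamma s - Complex.log s)
      (Complex.digamma (s + n) - Complex.log (s + n))
    rw [norm_sub_rev (Complex.digamma s - Complex.log s)] at h3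
    linarith
  have hlog : Tendsto (fun n : ℕ => Complex.log (s + (n + 1 : ℕ)) - Complex.log n) atTop (𝓝 0) := by
    have h1 : Tendsto (fun n : ℕ => Complex.log (1 + (s + 1) / n)) atTop (𝓝 0) := by
      have h2 : Tendsto (fun n : ℕ => 1 + (s + 1) / (n : ℂ)) atTop (𝓝 (1 + 0)) :=
        (tendsto_const_div_atTop_nhds_zero_nat (s + 1)).const_add 1
      rw [add_zero] at h2
      have := (continuousAt_clog (x := 1) (by simp)).tendsto.comp h2
      rw [Complex.log_one] at this
      exact this
    refine h1.congr' ?_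
    filter_upwards [eventually_ge_atTop 1] with n hn
    have hn0 : (0 : ℝ) < n := by exact_mod_cast hn
    have hne : 1 + (s + 1) / (n : ℂ) ≠ 0 := by
      intro h
      have h3 : s + (n + 1 : ℕ) = 0 := by
        have hnc : (n : ℂ) ≠ 0 := by exact_mod_cast hn0.ne'
        field_simp at h
        push_cast
        linear_combination h
      have := hpos (n + 1)
      rw [h3] at this
      simp at this
    have h4 := Complex.log_ofReal_mul hn0 hne
    have h5 : ((n : ℝ) : ℂ) * (1 + (s + 1) / n) = s + (n + 1 : ℕ) := by
      have hnc : (n : ℂ) ≠ 0 := by exact_mod_cast hn0.ne'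
      push_cast
      field_simp
      ring
    rw [h5] at h4
    rw [h4, Complex.ofReal_log hn0.le]
    simp
  have hlog2 : ∀ᶠ n : ℕ in atTop, ‖Complex.log (s + (n + 1 : ℕ)) - Complex.log n‖ < 1 := by
    have := hlog.norm
    rw [norm_zero] at this
    exact this.eventually_lt_const one_pos
  obtain ⟨n, hn1, hn2⟩ := ((eventually_norm_digamma_add_sub_log_le hs).and hlog2).exists
  have h1 := tele (n + 1)
  have h2 := hsum.sum_le_tsum (Finset.range (n + 1)) (fun k _ => by positivity)
  have h3 := norm_sub_le (Complex.digamma (s + (n + 1 : ℕ)) - Complex.log n)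
    (Complex.log (s + (n + 1 : ℕ)) - Complex.log n)
  rw [sub_sub_sub_cancel_right] at h3
  linarith

lemma norm_log_sub_log_two_add_abs_le (y : ℝ) :
    ‖Complex.log (1 + (y / 2 : ℝ) * Complex.I) - Real.log (2 + |y|)‖ ≤ 6 := by
  set s : ℂ := 1 + (y / 2 : ℝ) * Complex.I with hs
  have hre : s.re = 1 := by simp [hs]
  have him : s.im = y / 2 := by simp [hs]
  have hup : ‖s‖ ≤ 2 + |y| := by
    have := Complex.norm_le_abs_re_add_abs_im s
    rw [hre, him, abs_one, abs_div, abs_two] at this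
    linarith [abs_nonneg y]
  have hlow : (2 + |y|) / 4 ≤ ‖s‖ := by
    have h1 := Complex.abs_re_le_norm s
    have h2 := Complex.abs_im_le_norm s
    rw [hre, abs_one] at h1
    rw [him, abs_div, abs_two] at h2
    linarith
  have hy : 0 < 2 + |y| := by positivity
  have hspos : 0 < ‖s‖ := by linarith
  have h1 := Real.log_le_log hspos hup
  have h2 := Real.log_le_log (by linarith) hlow
  rw [Real.log_div hy.ne' (by norm_num)] at h2
  have h4 : Real.log 4 ≤ 2 := by
    rw [show (4 : ℝ) = 2 ^ 2 by norm_num, Real.log_pow]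
    have := Real.log_two_lt_d9
    push_cast; linarith
  refine (Complex.norm_le_abs_re_add_abs_im _).trans ?_
  rw [Complex.sub_re, Complex.sub_im, Complex.log_re, Complex.log_im, Complex.ofReal_re,
    Complex.ofReal_im, sub_zero]
  have h5 := Complex.abs_arg_le_pi s
  have h6 : |Real.log ‖s‖ - Real.log (2 + |y|)| ≤ 2 := by
    rw [abs_le]; constructor <;> linarith
  linarith [Real.pi_lt_four]

lemma norm_logDeriv_riemannZeta_le :
    ∃ C, ∀ s : ℂ, s.re = 2 → ‖logDeriv riemannZeta s‖ ≤ C := by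
  have hsum : Summable fun n => ‖LSeries.term (fun n => (ArithmeticFunction.vonMangoldt n : ℂ)) 2 n‖ :=
    (ArithmeticFunction.LSeriesSummable_vonMangoldt (s := 2) (by norm_num)).norm
  refine ⟨∑' n, ‖LSeries.term (fun n => (ArithmeticFunction.vonMangoldt n : ℂ)) 2 n‖,
    fun s hs => ?_⟩
  have h := ArithmeticFunction.LSeries_vonMangoldt_eq_deriv_riemannZeta_div
    (s := s) (by rw [hs]; norm_num)
  rw [logDeriv_apply, ← norm_neg, ← neg_div, ← h, LSeries]
  refine tsum_of_norm_bounded hsum.hasSum fun n => ?_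
  rw [LSeries.norm_term_eq, LSeries.norm_term_eq, hs]
  simp

lemma logDeriv_xi_eq {z : ℂ} (hz : 1 / 2 < z.re) :
    logDeriv xi z = (z - 1 / 2)⁻¹ + (z + 1 / 2)⁻¹ - Complex.log Real.pi / 2 +
      Complex.digamma ((1 / 2 + z) / 2) / 2 + logDeriv riemannZeta (1 / 2 + z) := by
  have hpi : (Real.pi : ℂ) ≠ 0 := by exact_mod_cast Real.pi_ne_zero
  have hz1 : z - 1 / 2 ≠ 0 := fun h => by
    have := congrArg Complex.re h
    simp at this; linarith
  have hz2 : z + 1 / 2 ≠ 0 := fun h => by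
    have := congrArg Complex.re h
    simp at this; linarith
  have hz3 : 1 / 2 + z ≠ 1 := fun h => hz1 (by linear_combination h)
  have hGne : Complex.Gamma ((1 / 2 + z) / 2) ≠ 0 :=
    Complex.Gamma_ne_zero_of_re_pos (by simp; linarith)
  have hζne : riemannZeta (1 / 2 + z) ≠ 0 :=
    riemannZeta_ne_zero_of_one_le_re (by simp; linarith)
  have hev : xi =ᶠ[𝓝 z] fun w => ((1 / 4 - w ^ 2) * Complex.exp (Complex.log Real.pi *
      (-(1 / 2 + w) / 2))) * (Complex.Gamma ((1 / 2 + w) / 2) * riemannZeta (1 / 2 + w)) := by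
    have hopen : {w : ℂ | 1 / 2 < w.re} ∈ 𝓝 z :=
      (isOpen_lt continuous_const Complex.continuous_re).mem_nhds hz
    filter_upwards [hopen] with w hw
    have hw' : 1 / 2 < w.re := hw
    rw [xi_eq_Gammaℝ_mul_riemannZeta, Complex.Gammaℝ_def, Complex.cpow_def_of_ne_zero hpi]
    · ring
    · rintro rfl; norm_num at hw'
    · rintro rfl; norm_num at hw'
    · exact Complex.Gammaℝ_ne_zero_of_re_pos (by simp; linarith)
  have hGd : DifferentiableAt ℂ Complex.Gamma ((1 / 2 + z) / 2) := by
    refine Complex.differentiableAt_Gamma _ fun m hm => ?_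
    have := congrArg Complex.re hm
    simp at this
    have h1 : (0 : ℝ) ≤ m := m.cast_nonneg
    linarith
  have d1 : HasDerivAt (fun w : ℂ => 1 / 4 - w ^ 2) (-(2 * z)) z :=
    ((hasDerivAt_pow 2 z).const_sub (1 / 4)).congr_deriv (by simp)
  have d0 : HasDerivAt (fun w : ℂ => 1 / 2 + w) 1 z := (hasDerivAt_id z).const_add _
  have d2 : HasDerivAt (fun w : ℂ => Complex.exp (Complex.log Real.pi * (-(1 / 2 + w) / 2)))
      (Complex.exp (Complex.log Real.pi * (-(1 / 2 + z) / 2)) * (Complex.log Real.pi * (-1 / 2))) z :=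
    ((d0.neg.div_const 2).const_mul _).cexp
  have d3 : HasDerivAt (fun w : ℂ => Complex.Gamma ((1 / 2 + w) / 2))
      (deriv Complex.Gamma ((1 / 2 + z) / 2) * (1 / 2)) z :=
    HasDerivAt.comp z hGd.hasDerivAt (d0.div_const 2)
  have d4 : HasDerivAt (fun w : ℂ => riemannZeta (1 / 2 + w))
      (deriv riemannZeta (1 / 2 + z) * 1) z :=
    HasDerivAt.comp z (differentiableAt_riemannZeta hz3).hasDerivAt d0
  have d5 := ((d1.mul d2).mul (d3.mul d4)).congr_of_eventuallyEq hev
  rw [logDeriv_apply, logDeriv_apply, d5.deriv, hev.eq_of_nhds, Complex.digamma_def,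
    logDeriv_apply]
  have hE := Complex.exp_ne_zero (Complex.log Real.pi * (-(1 / 2 + z) / 2))
  have hq : 1 / 4 - z ^ 2 = -((z - 1 / 2) * (z + 1 / 2)) := by ring
  have hq0 : 1 / 4 - z ^ 2 ≠ 0 := by rw [hq]; exact neg_ne_zero.mpr (mul_ne_zero hz1 hz2)
  have hsum : (z - 1 / 2)⁻¹ + (z + 1 / 2)⁻¹ = -(2 * z) / (1 / 4 - z ^ 2) := by
    rw [hq]
    generalize ha : z - 1 / 2 = a at *
    generalize hb : z + 1 / 2 = b at *
    have : 2 * z = a + b := by rw [← ha, ← hb]; ring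
    rw [this]
    field_simp
    ring
  rw [hsum]
  simp only [Pi.mul_apply]
  generalize 1 / 4 - z ^ 2 = q at *
  generalize Complex.exp (Complex.log Real.pi * (-(1 / 2 + z) / 2)) = E at *
  generalize deriv Complex.Gamma ((1 / 2 + z) / 2) = G' at *
  generalize Complex.Gamma ((1 / 2 + z) / 2) = G at *
  generalize deriv riemannZeta (1 / 2 + z) = Z' at *
  generalize riemannZeta (1 / 2 + z) = Z at *
  field_simp
  ring

lemma norm_logDeriv_xi_sub_half_log_le :
    ∃ C, 0 < C ∧ ∀ y : ℝ,
      ‖logDeriv xi (3 / 2 + y * Complex.I) - (Real.log (2 + |y|) / 2 : ℝ)‖ ≤ C := by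
  obtain ⟨C1, h1⟩ := norm_logDeriv_riemannZeta_le
  obtain ⟨C2, h2⟩ := norm_digamma_sub_log_le
  have hC1 : 0 ≤ C1 := (norm_nonneg _).trans (h1 2 (by simp))
  have hC2 : 0 ≤ C2 := (norm_nonneg _).trans (h2 1 (by simp))
  refine ⟨2 + ‖Complex.log Real.pi / 2‖ + (C2 + 6) + C1, by positivity, fun y => ?_⟩
  have e1 : (1 / 2 + (3 / 2 + y * Complex.I)) / 2 = 1 + (y / 2 : ℝ) * Complex.I := by
    push_cast; ring
  rw [logDeriv_xi_eq (by simp; norm_num), e1]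
  have i1 : ‖(3 / 2 + y * Complex.I - 1 / 2 : ℂ)⁻¹‖ ≤ 1 := by
    rw [norm_inv]
    refine inv_le_one_of_one_le₀ (le_trans (le_of_eq ?_) (Complex.re_le_norm _))
    simp; norm_num
  have i2 : ‖(3 / 2 + y * Complex.I + 1 / 2 : ℂ)⁻¹‖ ≤ 1 := by
    rw [norm_inv]
    refine inv_le_one_of_one_le₀ (le_trans ?_ (Complex.re_le_norm _))
    simp; norm_num
  have i3 := h1 (1 / 2 + (3 / 2 + y * Complex.I)) (by simp; norm_num)
  have i4 := h2 (1 + (y / 2 : ℝ) * Complex.I) (by simp)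
  have i5 := norm_log_sub_log_two_add_abs_le y
  set a := (3 / 2 + y * Complex.I - 1 / 2 : ℂ)⁻¹
  set b := (3 / 2 + y * Complex.I + 1 / 2 : ℂ)⁻¹
  set c := logDeriv riemannZeta (1 / 2 + (3 / 2 + y * Complex.I))
  set d := Complex.digamma (1 + (y / 2 : ℝ) * Complex.I)
  set l := Complex.log (1 + (y / 2 : ℝ) * Complex.I)
  set p := Complex.log Real.pi / 2
  rw [show a + b - p + d / 2 + c - (Real.log (2 + |y|) / 2 : ℝ) =
    a + b - p + ((d - l) + (l - Real.log (2 + |y|))) / 2 + c by push_cast; ring]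
  have j1 := norm_add_le (d - l) (l - Real.log (2 + |y|))
  have j2 : ‖((d - l) + (l - Real.log (2 + |y|))) / 2‖ ≤ C2 + 6 := by
    rw [norm_div, Complex.norm_two]
    linarith
  refine (norm_add_le _ _).trans (add_le_add ((norm_add_le _ _).trans (add_le_add ?_ j2)) i3)
  refine (norm_sub_le _ _).trans (add_le_add ((norm_add_le _ _).trans ?_) le_rfl)
  linarith

/-- The entire function `sin z / z`. -/
noncomputable def csinc : ℂ → ℂ := dslope Complex.sin 0

lemma differentiable_csinc : Differentiable ℂ csinc :=
  differentiableOn_univ.mp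
    ((Complex.differentiableOn_dslope univ_mem).mpr Complex.differentiable_sin.differentiableOn)

lemma csinc_ofReal (v : ℝ) : csinc v = (Real.sinc v : ℝ) := by
  rcases eq_or_ne v 0 with rfl | hv
  · simp [csinc, Complex.deriv_sin]
  · have hv' : (v : ℂ) ≠ 0 := by exact_mod_cast hv
    rw [csinc, dslope_of_ne _ hv', slope_def_field, Real.sinc_of_ne_zero hv]
    simp

lemma Complex.norm_cos_le_exp_abs_im (z : ℂ) : ‖Complex.cos z‖ ≤ Real.exp |z.im| := by
  rw [Complex.cos, norm_div, Complex.norm_two, div_le_iff₀ two_pos]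
  refine (norm_add_le _ _).trans ?_
  rw [Complex.norm_exp, Complex.norm_exp]
  have h1 : (z * Complex.I).re ≤ |z.im| := by simpa using neg_le_abs z.im
  have h2 : (-z * Complex.I).re ≤ |z.im| := by simpa using le_abs_self z.im
  have := Real.exp_le_exp.mpr h1
  have := Real.exp_le_exp.mpr h2
  linarith

lemma norm_csinc_le (z : ℂ) : ‖csinc z‖ ≤ Real.exp |z.im| := by
  rcases eq_or_ne z 0 with rfl | hz
  · simp [csinc, Complex.deriv_sin]
  have hconv : Convex ℝ {w : ℂ | |w.im| ≤ |z.im|} := by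
    have : {w : ℂ | |w.im| ≤ |z.im|} = Complex.imLm ⁻¹' Set.Icc (-|z.im|) |z.im| := by
      ext w; simp [abs_le]
    rw [this]
    exact (convex_Icc _ _).linear_preimage _
  have h := hconv.norm_image_sub_le_of_norm_deriv_le (f := Complex.sin) (C := Real.exp |z.im|)
    (x := 0) (y := z) (fun w _ => Complex.differentiable_sin w)
    (fun w hw => by
      rw [Complex.deriv_sin]
      exact (Complex.norm_cos_le_exp_abs_im w).trans (Real.exp_le_exp.mpr hw))
    (by simp) (by simp)
  rw [csinc, dslope_of_ne _ hz, slope_def_field, norm_div, div_le_iff₀ (by simpa using hz)]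
  exact h

/-- A test function adapted to the scale `1 / lam`: on the real line it is nonpositive outside
`[-10 / lam, 10 / lam]`, while its exponential type is `4 * lam`. -/
noncomputable def testFn (lam : ℝ) (z : ℂ) : ℂ :=
  ((10 / lam : ℝ) ^ 2 - z ^ 2) * csinc (lam * z) ^ 4 * Complex.exp (-z ^ 2)

lemma differentiable_testFn (lam : ℝ) : Differentiable ℂ (testFn lam) := by
  unfold testFn
  refine Differentiable.mul (Differentiable.mul (by fun_prop) (Differentiable.pow ?_ 4))
    (by fun_prop)
  exact differentiable_csinc.comp (differentiable_id.const_mul _)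

/-- The restriction of `testFn` to the real line. -/
noncomputable def testFnReal (lam u : ℝ) : ℝ :=
  ((10 / lam) ^ 2 - u ^ 2) * Real.sinc (lam * u) ^ 4 * Real.exp (-u ^ 2)

lemma testFn_ofReal (lam u : ℝ) : testFn lam u = (testFnReal lam u : ℝ) := by
  have h := csinc_ofReal (lam * u)
  push_cast at h
  unfold testFn testFnReal
  rw [h]
  push_cast
  rfl

lemma exp_neg_sq_le (u : ℝ) : Real.exp (-u ^ 2) ≤ 27 / (1 + u ^ 2) ^ 3 := by
  rw [Real.exp_neg, inv_le_comm₀ (Real.exp_pos _) (by positivity), inv_div,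
    show u ^ 2 = (3 : ℕ) * (u ^ 2 / 3) by push_cast; ring, Real.exp_nat_mul]
  have h1 := Real.add_one_le_exp (u ^ 2 / 3)
  have h2 : (u ^ 2 / 3 + 1) ^ 3 ≤ Real.exp (u ^ 2 / 3) ^ 3 := by gcongr
  refine le_trans ?_ h2
  have : (1 + (3 : ℕ) * (u ^ 2 / 3)) ^ 3 / 27 = ((1 + u ^ 2) / 3) ^ 3 := by push_cast; ring
  rw [this]
  have h3 : (1 + u ^ 2) / 3 ≤ u ^ 2 / 3 + 1 := by linarith
  gcongr

lemma norm_testFn_le {lam : ℝ} (hlam : 1 ≤ lam) (u : ℝ) {η : ℝ} (h0 : 0 ≤ η) (h1 : η ≤ 3 / 2) :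
    ‖testFn lam (u - η * Complex.I)‖ ≤
      2781 * Real.exp (9 / 4) * Real.exp (6 * lam) / (1 + u ^ 2) ^ 2 := by
  set z : ℂ := u - η * Complex.I with hz
  have hre : z.re = u := by simp [hz]
  have him : z.im = -η := by simp [hz]
  have a1 : ‖((10 / lam : ℝ) : ℂ) ^ 2 - z ^ 2‖ ≤ 103 * (1 + u ^ 2) := by
    refine (norm_sub_le _ _).trans ?_
    rw [norm_pow, norm_pow, Complex.norm_real, Real.norm_of_nonneg (by positivity),
      ← Complex.normSq_eq_norm_sq, Complex.normSq_apply, hre, him]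
    have : 10 / lam ≤ 10 := div_le_self (by norm_num) hlam
    have : (10 / lam) ^ 2 ≤ 10 ^ 2 := by gcongr
    nlinarith
  have a2 : ‖csinc (lam * z) ^ 4‖ ≤ Real.exp (6 * lam) := by
    rw [norm_pow]
    have h2 := norm_csinc_le (lam * z)
    have h3 : |(lam * z).im| = lam * η := by
      rw [Complex.im_ofReal_mul, him, mul_neg, abs_neg, abs_of_nonneg (by positivity)]
    rw [h3] at h2
    calc ‖csinc (lam * z)‖ ^ 4 ≤ Real.exp (lam * η) ^ 4 := by gcongr
      _ = Real.exp (4 * (lam * η)) := by rw [← Real.exp_nat_mul]; norm_num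
      _ ≤ Real.exp (6 * lam) := by
        rw [Real.exp_le_exp]; nlinarith
  have a3 : ‖Complex.exp (-z ^ 2)‖ ≤ Real.exp (9 / 4) * (27 / (1 + u ^ 2) ^ 3) := by
    rw [Complex.norm_exp]
    have e : (-z ^ 2).re = -u ^ 2 + η ^ 2 := by
      rw [Complex.neg_re, sq, Complex.mul_re, hre, him]; ring
    rw [e, Real.exp_add, mul_comm]
    have h2 : η ^ 2 ≤ 9 / 4 := by nlinarith
    gcongr
    exact exp_neg_sq_le u
  unfold testFn
  rw [norm_mul, norm_mul]
  calc _ ≤ 103 * (1 + u ^ 2) * Real.exp (6 * lam) *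
        (Real.exp (9 / 4) * (27 / (1 + u ^ 2) ^ 3)) := by gcongr
    _ = _ := by field_simp; ring

lemma testFnReal_nonpos {lam u : ℝ} (hlam : 0 < lam) (hu : 10 / lam < |u|) :
    testFnReal lam u ≤ 0 := by
  have h : (10 / lam) ^ 2 ≤ u ^ 2 := by
    rw [← sq_abs u]
    gcongr
  unfold testFnReal
  refine mul_nonpos_of_nonpos_of_nonneg (mul_nonpos_of_nonpos_of_nonneg (by linarith) ?_)
    (Real.exp_pos _).le
  positivity

lemma testFnReal_le {lam u : ℝ} : testFnReal lam u ≤ (10 / lam) ^ 2 := by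
  have h1 : Real.sinc (lam * u) ^ 4 ≤ 1 := by
    have := Real.abs_sinc_le_one (lam * u)
    calc _ = |Real.sinc (lam * u)| ^ 4 := by rw [pow_abs, abs_of_nonneg (by positivity)]
      _ ≤ 1 := pow_le_one₀ (abs_nonneg _) this
  have h2 : Real.exp (-u ^ 2) ≤ 1 := Real.exp_le_one_iff.mpr (by nlinarith)
  have h3 : 0 ≤ Real.sinc (lam * u) ^ 4 := by positivity
  unfold testFnReal
  rw [mul_assoc]
  have h4 : 0 ≤ Real.sinc (lam * u) ^ 4 * Real.exp (-u ^ 2) := by positivity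
  have h5 : Real.sinc (lam * u) ^ 4 * Real.exp (-u ^ 2) ≤ 1 := mul_le_one₀ h1 (by positivity) h2
  nlinarith [sq_nonneg (10 / lam), sq_nonneg u]

lemma testFnReal_nonneg {lam u : ℝ} (hu : |u| ≤ 10 / lam) :
    0 ≤ testFnReal lam u := by
  have h : u ^ 2 ≤ (10 / lam) ^ 2 := by
    rw [← sq_abs u]
    gcongr
  unfold testFnReal
  have : 0 ≤ (10 / lam) ^ 2 - u ^ 2 := by linarith
  positivity

lemma five_sixths_le_sinc {v : ℝ} (hv : |v| ≤ 1) : 5 / 6 ≤ Real.sinc v := by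
  wlog h : 0 ≤ v generalizing v
  · rw [← Real.sinc_neg]
    exact this (by rwa [abs_neg]) (by linarith)
  rcases h.eq_or_lt with rfl | h
  · norm_num
  rw [abs_of_pos h] at hv
  rw [Real.sinc_of_ne_zero h.ne', le_div_iff₀ h]
  have h1 := Real.sin_gt_sub_cube h
  have h2 : v ^ 3 ≤ v := by
    rw [pow_succ]
    exact mul_le_of_le_one_left h.le (pow_le_one₀ h.le hv)
  linarith

lemma testFnReal_lower {lam : ℝ} (hlam : 1 ≤ lam) (u : ℝ) :
    (Set.indicator (Set.Icc (-1) 1) (fun _ => (15 : ℝ)) (lam * u) - 2 * (1 + (lam * u) ^ 2)⁻¹) /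
      lam ^ 2 ≤ testFnReal lam u := by
  have hl : 0 < lam := by linarith
  set v := lam * u with hv
  have e : testFnReal lam u = (100 - v ^ 2) * Real.sinc v ^ 4 * Real.exp (-u ^ 2) / lam ^ 2 := by
    unfold testFnReal
    rw [← hv, show u = v / lam by rw [hv]; field_simp]
    field_simp
    ring
  rw [e]
  gcongr
  have hpos : 0 < (1 + v ^ 2)⁻¹ := by positivity
  have hs0 : 0 ≤ Real.sinc v ^ 4 := by positivity
  by_cases hv1 : v ∈ Set.Icc (-1 : ℝ) 1
  · rw [Set.indicator_of_mem hv1]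
    have hvabs : |v| ≤ 1 := abs_le.mpr hv1
    have hv2 : v ^ 2 ≤ 1 := by rw [← sq_abs]; exact pow_le_one₀ (abs_nonneg _) hvabs
    have hsinc : 5 / 6 ≤ Real.sinc v := five_sixths_le_sinc hvabs
    have hs4 : (5 / 6 : ℝ) ^ 4 ≤ Real.sinc v ^ 4 := by gcongr
    have hexp : 1 / 3 ≤ Real.exp (-u ^ 2) := by
      have hu : u ^ 2 ≤ 1 := by
        have : u ^ 2 ≤ v ^ 2 := by
          rw [hv, mul_pow]
          exact le_mul_of_one_le_left (sq_nonneg u) (one_le_pow₀ hlam)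
        linarith
      have h1 : Real.exp (-1) ≤ Real.exp (-u ^ 2) := Real.exp_le_exp.mpr (by linarith)
      have h2 : 1 / 3 ≤ Real.exp (-1) := by
        rw [Real.exp_neg, one_div]
        exact inv_anti₀ (Real.exp_pos _) (by linarith [Real.exp_one_lt_d9])
      linarith
    have h3 : 99 * (5 / 6 : ℝ) ^ 4 * (1 / 3) ≤ (100 - v ^ 2) * Real.sinc v ^ 4 * Real.exp (-u ^ 2) := by
      have : (0 : ℝ) ≤ 100 - v ^ 2 := by linarith
      gcongr
      linarith
    norm_num at h3
    linarith
  · rw [Set.indicator_of_notMem hv1]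
    have hv0 : v ≠ 0 := fun h => hv1 (by simp [h])
    have hexp : Real.exp (-u ^ 2) ≤ 1 := Real.exp_le_one_iff.mpr (by nlinarith)
    have hexp0 := Real.exp_pos (-u ^ 2)
    rcases le_total (v ^ 2) 100 with h | h
    · have : 0 ≤ (100 - v ^ 2) * Real.sinc v ^ 4 * Real.exp (-u ^ 2) := by
        have : 0 ≤ 100 - v ^ 2 := by linarith
        positivity
      linarith
    · have hv2 : 0 < v ^ 2 := by positivity
      have hsinc : Real.sinc v ^ 4 ≤ 1 / (v ^ 2 * v ^ 2) := by
        rw [Real.sinc_of_ne_zero hv0, div_pow, ← pow_add]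
        have h1 := Real.sin_sq_le_one v
        have h2 : Real.sin v ^ 4 ≤ 1 := by
          nlinarith [sq_nonneg (Real.sin v)]
        gcongr
      have h1 : (v ^ 2 - 100) * (Real.sinc v ^ 4 * Real.exp (-u ^ 2)) ≤
          v ^ 2 * (1 / (v ^ 2 * v ^ 2) * 1) := by
        gcongr
        linarith
      have h2 : v ^ 2 * (1 / (v ^ 2 * v ^ 2) * 1) ≤ 2 * (1 + v ^ 2)⁻¹ := by
        field_simp
        rw [div_le_iff₀ hv2]
        linarith
      linarith

lemma integral_testFnReal_ge {lam : ℝ} (hlam : 1 ≤ lam)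
    (hInt : MeasureTheory.Integrable (testFnReal lam)) :
    1 / lam ^ 3 ≤ ∫ u, testFnReal lam u := by
  have hl : 0 < lam := by linarith
  set m : ℝ → ℝ := fun v =>
    Set.indicator (Set.Icc (-1) 1) (fun _ => (15 : ℝ)) v - 2 * (1 + v ^ 2)⁻¹ with hm
  have i1 : MeasureTheory.Integrable (Set.indicator (Set.Icc (-1 : ℝ) 1) (fun _ => (15 : ℝ))) :=
    (MeasureTheory.integrable_indicator_iff measurableSet_Icc).mpr (by simp)
  have i2 : MeasureTheory.Integrable fun v : ℝ => 2 * (1 + v ^ 2)⁻¹ :=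
    integrable_inv_one_add_sq.const_mul 2
  have im : MeasureTheory.Integrable m := i1.sub i2
  have hmval : ∫ v, m v = 30 - 2 * Real.pi := by
    simp only [hm]
    rw [MeasureTheory.integral_sub i1 i2, MeasureTheory.integral_indicator measurableSet_Icc,
      MeasureTheory.integral_const_mul, integral_univ_inv_one_add_sq]
    norm_num
  have hscale : ∫ u, m (lam * u) / lam ^ 2 = (30 - 2 * Real.pi) / lam ^ 3 := by
    rw [MeasureTheory.integral_div, MeasureTheory.Measure.integral_comp_mul_left, hmval,
      abs_of_pos (inv_pos.mpr hl), smul_eq_mul]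
    field_simp
  calc 1 / lam ^ 3 ≤ (30 - 2 * Real.pi) / lam ^ 3 := by
        gcongr
        linarith [Real.pi_lt_four]
    _ = ∫ u, m (lam * u) / lam ^ 2 := hscale.symm
    _ ≤ _ := MeasureTheory.integral_mono ((im.comp_mul_left' hl.ne').div_const _) hInt
        (testFnReal_lower hlam)

lemma differentiableAt_logDeriv_xi (RH : RiemannHypothesis) {z : ℂ} (hz : 0 < z.re) :
    DifferentiableAt ℂ (logDeriv xi) z :=
  (differentiable_xi.analyticAt z).deriv.differentiableAt.div (differentiable_xi z)
    (xi_ne_zero_of_re_pos RH hz)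

lemma norm_logDeriv_xi_le (RH : RiemannHypothesis) {δ : ℝ} (hδ : 0 < δ) :
    ∃ K, 0 < K ∧ ∀ x y : ℝ, δ ≤ x → x ≤ 3 / 2 →
      ‖logDeriv xi (x + y * Complex.I)‖ ≤ K * (2 + |y|) := by
  obtain ⟨C, hC, h⟩ := norm_logDeriv_xi_sub_half_log_le
  refine ⟨3 / δ * (2 + C), by positivity, fun x y hx hx2 => ?_⟩
  have hmap : ∀ w ∈ Metric.ball (0 : ℂ) (3 / 2), 0 < (w + (3 / 2 + y * Complex.I)).re := by
    intro w hw
    rw [mem_ball_zero_iff] at hw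
    have := (abs_lt.mp ((Complex.abs_re_le_norm w).trans_lt hw)).1
    have e : (w + (3 / 2 + y * Complex.I)).re = w.re + 3 / 2 := by simp
    rw [e]; linarith
  have hnorm : ‖((x - 3 / 2 : ℝ) : ℂ)‖ = 3 / 2 - x := by
    rw [Complex.norm_real, Real.norm_eq_abs, abs_of_nonpos (by linarith)]; ring
  have key := Complex.borelCaratheodory (M := 1) (R := 3 / 2) (z := ((x - 3 / 2 : ℝ) : ℂ))
    (f := fun w => -logDeriv xi (w + (3 / 2 + y * Complex.I))) one_pos
    (fun w hw => by
      have h1 := differentiableAt_logDeriv_xi RH (hmap w hw)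
      exact (h1.comp w (by fun_prop : DifferentiableAt ℂ
        (fun w => w + (3 / 2 + y * Complex.I)) w)).neg.differentiableWithinAt)
    (fun w hw => by
      have := re_logDeriv_xi_nonneg RH (hmap w hw)
      simp only [Set.mem_ofPred_eq, Complex.neg_re]
      linarith) (by norm_num)
    (by rw [mem_ball_zero_iff, hnorm]; linarith)
  have e1 : ((x - 3 / 2 : ℝ) : ℂ) + (3 / 2 + y * Complex.I) = x + y * Complex.I := by
    push_cast; ring
  rw [hnorm, norm_neg, e1, norm_neg, zero_add] at key
  have h0 : ‖logDeriv xi (3 / 2 + y * Complex.I)‖ ≤ C + (1 + |y|) := by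
    have h3 : ‖((Real.log (2 + |y|) / 2 : ℝ) : ℂ)‖ ≤ 1 + |y| := by
      have := abs_nonneg y
      have h4 := Real.log_le_sub_one_of_pos (show 0 < 2 + |y| by positivity)
      have h5 := Real.log_nonneg (show 1 ≤ 2 + |y| by linarith)
      rw [Complex.norm_real, Real.norm_eq_abs, abs_of_nonneg (by positivity)]
      linarith
    have h4 := norm_sub_norm_le (logDeriv xi (3 / 2 + y * Complex.I))
      ((Real.log (2 + |y|) / 2 : ℝ) : ℂ)
    have h5 := h y
    linarith
  have hx0 : 0 < x := by linarith
  have hxx : 3 / 2 - (3 / 2 - x) = x := by ring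
  rw [hxx] at key
  have hy := abs_nonneg y
  calc _ ≤ _ := key
    _ ≤ 2 * 1 * (3 / 2) / δ + (C + (1 + |y|)) * 3 / δ := by
        gcongr <;> linarith
    _ = 3 / δ * (2 + C + |y|) := by field_simp; ring
    _ ≤ 3 / δ * ((2 + C) * (2 + |y|)) := by gcongr; nlinarith
    _ = _ := by ring

lemma integrable_of_norm_le_div_one_add_sq {f : ℝ → ℂ} {K : ℝ} (hf : Continuous f)
    (h : ∀ u, ‖f u‖ ≤ K / (1 + u ^ 2)) : MeasureTheory.Integrable f :=
  (integrable_inv_one_add_sq.const_mul K).mono' hf.aestronglyMeasurable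
    (Eventually.of_forall fun u => by simpa [div_eq_mul_inv] using h u)

lemma integral_vertical_line_eq {f : ℂ → ℂ} {a b K : ℝ} (hab : a ≤ b)
    (hf : ∀ z : ℂ, a ≤ z.re → z.re ≤ b → DifferentiableAt ℂ f z)
    (hK : ∀ x u : ℝ, a ≤ x → x ≤ b → ‖f (x + u * Complex.I)‖ ≤ K / (1 + u ^ 2)) :
    ∫ u : ℝ, f (a + u * Complex.I) = ∫ u : ℝ, f (b + u * Complex.I) := by
  have hline : ∀ x : ℝ, a ≤ x → x ≤ b →
      MeasureTheory.Integrable fun u : ℝ => f (x + u * Complex.I) := by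
    intro x hx hx'
    refine integrable_of_norm_le_div_one_add_sq (K := K) ?_ fun u => hK x u hx hx'
    refine continuous_iff_continuousAt.mpr fun u => ?_
    exact ContinuousAt.comp (f := fun u : ℝ => (x : ℂ) + u * Complex.I)
      (hf _ (by simpa using hx) (by simpa using hx')).continuousAt (by fun_prop)
  have hlim : ∀ x : ℝ, a ≤ x → x ≤ b → Tendsto
      (fun U : ℝ => ∫ u in (-U)..U, f (x + u * Complex.I)) atTop
      (𝓝 (∫ u : ℝ, f (x + u * Complex.I))) := fun x hx hx' =>
    MeasureTheory.intervalIntegral_tendsto_integral (hline x hx hx')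
      tendsto_neg_atTop_atBot tendsto_id
  have hdecay : Tendsto (fun U : ℝ => K / (1 + U ^ 2) * |b - a|) atTop (𝓝 0) := by
    have h1 : Tendsto (fun U : ℝ => 1 + U ^ 2) atTop atTop :=
      tendsto_atTop_add_const_left _ _ (tendsto_pow_atTop two_ne_zero)
    simpa using (h1.const_div_atTop K).mul_const |b - a|
  have hhor : ∀ s : ℝ, s ^ 2 = 1 → Tendsto
      (fun U : ℝ => ∫ x in a..b, f (x + (s * U : ℝ) * Complex.I)) atTop (𝓝 0) := by
    intro s hs
    refine squeeze_zero_norm (fun U => ?_) hdecay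
    refine intervalIntegral.norm_integral_le_of_norm_le_const fun x hx => ?_
    rw [Set.uIoc_of_le hab] at hx
    have := hK x (s * U) hx.1.le hx.2
    rwa [mul_pow, hs, one_mul] at this
  have hrect : ∀ U : ℝ, (∫ x in a..b, f (x + ((-1 : ℝ) * U : ℝ) * Complex.I)) -
      (∫ x in a..b, f (x + ((1 : ℝ) * U : ℝ) * Complex.I)) +
      Complex.I • (∫ u in (-U)..U, f (b + u * Complex.I)) -
      Complex.I • (∫ u in (-U)..U, f (a + u * Complex.I)) = 0 := by
    intro U
    have := Complex.integral_boundary_rect_eq_zero_of_differentiableOn f ⟨a, -U⟩ ⟨b, U⟩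
      (fun z hz => by
        have hz1 := hz.1
        rw [Set.mem_preimage, Set.uIcc_of_le hab] at hz1
        exact (hf z hz1.1 hz1.2).differentiableWithinAt)
    simpa using this
  have hT := ((hhor (-1) (by norm_num)).sub (hhor 1 (by norm_num))).add
    ((hlim b hab le_rfl).const_smul Complex.I) |>.sub ((hlim a le_rfl hab).const_smul Complex.I)
  have h0 := tendsto_nhds_unique (hT.congr hrect) tendsto_const_nhds
  rw [sub_self, zero_add, ← smul_sub, smul_eq_zero] at h0
  exact (sub_eq_zero.mp (h0.resolve_left Complex.I_ne_zero)).symm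

lemma abs_log_two_add_abs_sub_log_le {τ : ℝ} (hτ : 1 ≤ τ) (u : ℝ) :
    |Real.log (2 + |u + τ|) - Real.log τ| ≤ 2 + |u| := by
  have hu := abs_nonneg u
  have hs := abs_nonneg (u + τ)
  have hτ0 : 0 < τ := by linarith
  rw [abs_le]
  constructor
  · have h1 : Real.log τ ≤ Real.log ((2 + |u + τ|) * (1 + |u|)) := by
      refine Real.log_le_log hτ0 ?_
      have := le_abs_self (u + τ)
      have := neg_abs_le u
      nlinarith
    rw [Real.log_mul (by positivity) (by positivity)] at h1
    have := Real.log_le_sub_one_of_pos (show 0 < 1 + |u| by positivity)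
    linarith
  · have h1 : Real.log (2 + |u + τ|) ≤ Real.log (τ * (3 + |u|)) := by
      refine Real.log_le_log (by positivity) ?_
      have := abs_add_le u τ
      rw [abs_of_pos hτ0] at this
      nlinarith
    rw [Real.log_mul (by positivity) (by positivity)] at h1
    have := Real.log_le_sub_one_of_pos (show 0 < 3 + |u| by positivity)
    linarith

lemma exists_re_logDeriv_xi_le_one {τ b : ℝ} (h : ∀ y : ℝ, |y - τ| ≤ b → xi (y * Complex.I) ≠ 0) :
    ∃ δ : ℝ, 0 < δ ∧ δ ≤ 1 ∧ ∀ u ∈ Set.Icc (-b) b,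
      (logDeriv xi (δ + (u + τ : ℝ) * Complex.I)).re ≤ 1 := by
  have key : ∀ᶠ δ : ℝ in 𝓝 0, ∀ u ∈ Set.Icc (-b) b,
      (logDeriv xi (δ + (u + τ : ℝ) * Complex.I)).re < 1 := by
    refine isCompact_Icc.eventually_forall_of_forall_eventually fun u hu => ?_
    have e0 : ((0 : ℝ) : ℂ) + (u + τ : ℝ) * Complex.I = (u + τ : ℝ) * Complex.I := by simp
    have hne : xi (((0 : ℝ) : ℂ) + (u + τ : ℝ) * Complex.I) ≠ 0 := by
      rw [e0]
      exact h _ (by rw [add_sub_cancel_right]; exact abs_le.mpr hu)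
    have hc : ContinuousAt (logDeriv xi) (((0 : ℝ) : ℂ) + (u + τ : ℝ) * Complex.I) :=
      (((differentiable_xi.analyticAt _).deriv.differentiableAt).div (differentiable_xi _)
        hne).continuousAt
    have hc2 : ContinuousAt (fun p : ℝ × ℝ =>
        (logDeriv xi (p.1 + (p.2 + τ : ℝ) * Complex.I)).re) (0, u) :=
      Complex.continuous_re.continuousAt.comp
        (ContinuousAt.comp (f := fun p : ℝ × ℝ => (p.1 : ℂ) + (p.2 + τ : ℝ) * Complex.I) hc
          (by fun_prop))
    refine hc2.eventually_lt_const ?_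
    beta_reduce
    rw [re_logDeriv_xi_of_re_eq_zero (by simp)]
    exact one_pos
  obtain ⟨δ, hδ, h0, h1⟩ := ((key.filter_mono nhdsWithin_le_nhds).and
    (Ioc_mem_nhdsGT (zero_lt_one' ℝ))).exists
  exact ⟨δ, h0, h1, fun u hu => (hδ u hu).le⟩

lemma norm_testFn_mul_le {lam τ K L : ℝ} (hlam : 1 ≤ lam) (hK : 0 ≤ K) {x δ u : ℝ} {g : ℂ}
    (h0 : δ ≤ x) (h1 : x - δ ≤ 3 / 2) (hg : ‖g‖ ≤ K * (2 + |u + τ|)) :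
    ‖(g - L) * testFn lam (-Complex.I * (x + u * Complex.I - δ))‖ ≤
      (K * (2 + |τ|) * 2 + |L|) * (2781 * Real.exp (9 / 4) * Real.exp (6 * lam)) / (1 + u ^ 2) := by
  have e : -Complex.I * (x + u * Complex.I - δ) = u - (x - δ : ℝ) * Complex.I := by
    push_cast
    linear_combination (-(u : ℂ)) * Complex.I_sq
  have hF := norm_testFn_le hlam u (sub_nonneg.mpr h0) h1
  rw [e, norm_mul]
  have hu := abs_nonneg u
  have hτ := abs_nonneg τ
  have hsq := sq_abs u
  have hG : ‖g - L‖ ≤ (K * (2 + |τ|) * 2 + |L|) * (1 + u ^ 2) := by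
    have h2 : ‖g - L‖ ≤ ‖g‖ + |L| := by
      simpa using norm_sub_le g (L : ℂ)
    have h3 : 2 + |u + τ| ≤ (2 + |τ|) * 2 * (1 + u ^ 2) := by
      have := abs_add_le u τ
      nlinarith [sq_nonneg (|u| - 1), mul_nonneg hτ (sq_nonneg |u|)]
    have h4 : K * (2 + |u + τ|) ≤ K * ((2 + |τ|) * 2 * (1 + u ^ 2)) := by gcongr
    have h5 : |L| ≤ |L| * (1 + u ^ 2) :=
      le_mul_of_one_le_right (abs_nonneg L) (by nlinarith)
    linarith
  calc _ ≤ _ := mul_le_mul hG hF (norm_nonneg _) (by positivity)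
    _ = _ := by field_simp

lemma integral_inv_one_add_sq_bound {f : ℝ → ℂ} {K : ℝ}
    (h : ∀ u, ‖f u‖ ≤ K / (1 + u ^ 2)) : ‖∫ u, f u‖ ≤ K * Real.pi := by
  rw [← integral_univ_inv_one_add_sq, ← MeasureTheory.integral_const_mul]
  exact MeasureTheory.norm_integral_le_of_norm_le (integrable_inv_one_add_sq.const_mul K)
    (Eventually.of_forall fun u => by simpa [div_eq_mul_inv] using h u)

lemma integrable_testFnReal {lam : ℝ} (hlam : 1 ≤ lam) :
    MeasureTheory.Integrable (testFnReal lam) := by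
  have h : MeasureTheory.Integrable fun u : ℝ => testFn lam u := by
    refine integrable_of_norm_le_div_one_add_sq
      (K := 2781 * Real.exp (9 / 4) * Real.exp (6 * lam))
      ((differentiable_testFn lam).continuous.comp Complex.continuous_ofReal) fun u => ?_
    have h1 := norm_testFn_le hlam u le_rfl (by norm_num)
    simp only [Complex.ofReal_zero, zero_mul, sub_zero] at h1
    refine h1.trans ?_
    gcongr
    nlinarith [sq_nonneg u]
  simpa [testFn_ofReal] using h.re

lemma log_le_of_xi_ne_zero (RH : RiemannHypothesis) :
    ∃ C, 0 < C ∧ ∀ τ lam : ℝ, 1 ≤ τ → 1 ≤ lam →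
      (∀ y : ℝ, |y - τ| ≤ 10 / lam → xi (y * Complex.I) ≠ 0) →
      Real.log τ ≤ 4000 + C * (lam ^ 3 * Real.exp (6 * lam)) := by
  obtain ⟨C, hC, hline⟩ := norm_logDeriv_xi_sub_half_log_le
  set M : ℝ := (C + 2) * (2781 * Real.exp (9 / 4)) * Real.pi with hM
  refine ⟨2 * M, by have := Real.pi_pos; positivity, fun τ lam hτ hlam hzero => ?_⟩
  have hl : 0 < lam := by linarith
  obtain ⟨δ, hδ0, hδ1, hδ⟩ := exists_re_logDeriv_xi_le_one hzero
  obtain ⟨K, hK, hKb⟩ := norm_logDeriv_xi_le RH hδ0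
  set L : ℝ := Real.log τ / 2 with hL
  have hL0 : 0 ≤ L := by have := Real.log_nonneg hτ; positivity
  set φ : ℂ → ℂ := fun z =>
    (logDeriv xi (z + τ * Complex.I) - L) * testFn lam (-Complex.I * (z - δ)) with hφ
  have eτ : ∀ x u : ℝ, (x : ℂ) + u * Complex.I + τ * Complex.I =
      x + (u + τ : ℝ) * Complex.I := fun x u => by push_cast; ring
  have hφb : ∀ x u : ℝ, δ ≤ x → x ≤ 3 / 2 → ‖φ (x + u * Complex.I)‖ ≤
      (K * (2 + |τ|) * 2 + |L|) * (2781 * Real.exp (9 / 4) * Real.exp (6 * lam)) /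
        (1 + u ^ 2) := by
    intro x u hx hx'
    refine norm_testFn_mul_le hlam hK.le hx (by linarith) ?_
    rw [eτ]
    exact hKb x (u + τ) hx hx'
  have hdiff : ∀ z : ℂ, δ ≤ z.re → z.re ≤ 3 / 2 → DifferentiableAt ℂ φ z := by
    intro z hz _
    have h1 : DifferentiableAt ℂ (logDeriv xi) (z + τ * Complex.I) :=
      differentiableAt_logDeriv_xi RH (by simp; linarith)
    have h2 : DifferentiableAt ℂ (fun z => logDeriv xi (z + τ * Complex.I)) z :=
      DifferentiableAt.comp (f := fun z : ℂ => z + τ * Complex.I) z h1 (by fun_prop)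
    have h3 : DifferentiableAt ℂ (fun z : ℂ => testFn lam (-Complex.I * (z - δ))) z :=
      DifferentiableAt.comp (f := fun z : ℂ => -Complex.I * (z - δ)) z
        (differentiable_testFn lam _) (by fun_prop)
    exact (h2.sub_const _).mul h3
  have hshift := integral_vertical_line_eq (by linarith) hdiff hφb
  have hright : ‖∫ u : ℝ, φ ((3 / 2 : ℝ) + u * Complex.I)‖ ≤ M * Real.exp (6 * lam) := by
    have : M * Real.exp (6 * lam) =
        ((C + 2) * (2781 * Real.exp (9 / 4) * Real.exp (6 * lam))) * Real.pi := by
      rw [hM]; ring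
    rw [this]
    refine integral_inv_one_add_sq_bound fun u => ?_
    have hg : ‖logDeriv xi ((3 / 2 : ℝ) + u * Complex.I + τ * Complex.I) - L‖ ≤
        (C + 2) * (1 + u ^ 2) := by
      rw [eτ]
      have h1 := hline (u + τ)
      have h2 := abs_log_two_add_abs_sub_log_le hτ u
      have h3 : ‖((Real.log (2 + |u + τ|) / 2 : ℝ) : ℂ) - L‖ ≤ 1 + |u| / 2 := by
        rw [← Complex.ofReal_sub, Complex.norm_real, Real.norm_eq_abs, hL, ← sub_div, abs_div,
          abs_two]
        linarith
      have h4 := norm_sub_le_norm_sub_add_norm_sub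
        (logDeriv xi (3 / 2 + (u + τ : ℝ) * Complex.I))
        ((Real.log (2 + |u + τ|) / 2 : ℝ) : ℂ) L
      have e : (((3 / 2 : ℝ) : ℂ)) = 3 / 2 := by push_cast; rfl
      rw [e]
      have h5 := sq_abs u
      nlinarith [sq_nonneg (|u| - 1), mul_nonneg hC.le (sq_nonneg u)]
    have e : -Complex.I * ((3 / 2 : ℝ) + u * Complex.I - δ) =
        u - (3 / 2 - δ : ℝ) * Complex.I := by
      push_cast
      linear_combination (-(u : ℂ)) * Complex.I_sq
    have hF := norm_testFn_le hlam u (η := 3 / 2 - δ) (by linarith) (by linarith)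
    rw [hφ]
    simp only
    rw [e, norm_mul]
    calc _ ≤ _ := mul_le_mul hg hF (norm_nonneg _) (by positivity)
      _ = _ := by field_simp
  set b : ℝ := 10 / lam with hb
  have hb0 : 0 < b := by positivity
  have hφre : ∀ u : ℝ, (φ (δ + u * Complex.I)).re =
      ((logDeriv xi (δ + (u + τ : ℝ) * Complex.I)).re - L) * testFnReal lam u := by
    intro u
    have e : -Complex.I * ((δ : ℂ) + u * Complex.I - δ) = u := by
      linear_combination (-(u : ℂ)) * Complex.I_sq
    rw [hφ]
    simp only
    rw [e, eτ, testFn_ofReal, Complex.re_mul_ofReal, Complex.sub_re, Complex.ofReal_re]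
  have hpt : ∀ u : ℝ, (φ (δ + u * Complex.I)).re ≤
      Set.indicator (Set.Icc (-b) b) (fun _ => b ^ 2) u - L * testFnReal lam u := by
    intro u
    rw [hφre, sub_mul]
    have hnn := re_logDeriv_xi_nonneg RH (z := δ + (u + τ : ℝ) * Complex.I)
      (by simpa using hδ0)
    refine sub_le_sub_right ?_ _
    by_cases hu : u ∈ Set.Icc (-b) b
    · rw [Set.indicator_of_mem hu]
      have h1 := hδ u hu
      have h2 := testFnReal_nonneg (lam := lam) (abs_le.mpr hu)
      have h3 := testFnReal_le (lam := lam) (u := u)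
      nlinarith
    · rw [Set.indicator_of_notMem hu]
      exact mul_nonpos_of_nonneg_of_nonpos hnn
        (testFnReal_nonpos hl (not_le.mp fun h => hu (abs_le.mp h)))
  have hInt : MeasureTheory.Integrable fun u : ℝ => φ (δ + u * Complex.I) := by
    refine integrable_of_norm_le_div_one_add_sq ?_ fun u => hφb δ u le_rfl (by linarith)
    refine continuous_iff_continuousAt.mpr fun u => ?_
    exact ContinuousAt.comp (f := fun u : ℝ => (δ : ℂ) + u * Complex.I)
      (hdiff _ (by simp) (by simp; linarith)).continuousAt (by fun_prop)
  have hF := integrable_testFnReal hlam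
  have hind : MeasureTheory.Integrable (Set.indicator (Set.Icc (-b) b) (fun _ => b ^ 2)) :=
    (MeasureTheory.integrable_indicator_iff measurableSet_Icc).mpr (by simp)
  have hle := MeasureTheory.integral_mono hInt.re (hind.sub (hF.const_mul L)) hpt
  have hre : ∫ u : ℝ, RCLike.re (φ (δ + u * Complex.I)) =
      (∫ u : ℝ, φ (δ + u * Complex.I)).re := integral_re hInt
  have hindv : ∫ u, Set.indicator (Set.Icc (-b) b) (fun _ => b ^ 2) u = 2 * b ^ 3 := by
    rw [MeasureTheory.integral_indicator measurableSet_Icc]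
    simp only [MeasureTheory.integral_const, MeasureTheory.measureReal_restrict_apply_univ,
      Real.volume_real_Icc_of_le (show -b ≤ b by linarith), smul_eq_mul]
    ring
  have hsub : ∫ u, (Set.indicator (Set.Icc (-b) b) (fun _ => b ^ 2) -
      fun u => L * testFnReal lam u) u = 2 * b ^ 3 - L * ∫ u, testFnReal lam u := by
    rw [← hindv, ← MeasureTheory.integral_const_mul]
    exact MeasureTheory.integral_sub hind (hF.const_mul L)
  rw [hre, hsub, hshift] at hle
  have hlow := (abs_le.mp ((Complex.abs_re_le_norm _).trans hright)).1
  have hFl := mul_le_mul_of_nonneg_left (integral_testFnReal_ge hlam hF) hL0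
  have hfin : L * (1 / lam ^ 3) ≤ 2 * b ^ 3 + M * Real.exp (6 * lam) := by linarith
  have hl3 : 0 < lam ^ 3 := by positivity
  have e1 : lam ^ 3 * (L * (1 / lam ^ 3)) = L := by field_simp
  have e2 : lam ^ 3 * (2 * b ^ 3 + M * Real.exp (6 * lam)) =
      2000 + M * (lam ^ 3 * Real.exp (6 * lam)) := by
    rw [hb]; field_simp; norm_num
  have := mul_le_mul_of_nonneg_left hfin hl3.le
  rw [e1, e2, hL] at this
  linarith

lemma eventually_exists_xi_eq_zero (RH : RiemannHypothesis) :
    ∀ᶠ τ : ℝ in atTop, ∃ y : ℝ, |y - τ| ≤ 120 / Real.log (Real.log τ) ∧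
      xi (y * Complex.I) = 0 := by
  obtain ⟨C, hC, h⟩ := log_le_of_xi_ne_zero RH
  have hgrow : ∀ᶠ lam : ℝ in atTop,
      4000 + C * (lam ^ 3 * Real.exp (6 * lam)) < Real.exp (12 * lam) := by
    filter_upwards [(Real.tendsto_pow_mul_exp_neg_atTop_nhds_zero 3).eventually_lt_const one_pos,
      Real.tendsto_exp_atTop.eventually_ge_atTop (4001 + C), eventually_ge_atTop 0]
      with lam h1 h2 h3
    have hcube : lam ^ 3 < Real.exp lam := by
      rw [Real.exp_neg, ← div_eq_mul_inv, div_lt_one (Real.exp_pos _)] at h1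
      exact h1
    have h7 : 1 ≤ Real.exp (7 * lam) := Real.one_le_exp (by linarith)
    have e7 : Real.exp (7 * lam) = Real.exp lam * Real.exp (6 * lam) := by
      rw [← Real.exp_add]; ring_nf
    have e8 : Real.exp (8 * lam) = Real.exp lam * Real.exp (7 * lam) := by
      rw [← Real.exp_add]; ring_nf
    have h12 : Real.exp (8 * lam) ≤ Real.exp (12 * lam) := Real.exp_le_exp.mpr (by linarith)
    have hc : C * (lam ^ 3 * Real.exp (6 * lam)) ≤ C * Real.exp (7 * lam) := by
      rw [e7]; gcongr
    nlinarith
  have hll : Tendsto (fun τ : ℝ => Real.log (Real.log τ) / 12) atTop atTop :=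
    (Real.tendsto_log_atTop.comp Real.tendsto_log_atTop).atTop_div_const (by norm_num)
  filter_upwards [hll.eventually hgrow, hll.eventually_ge_atTop 1, eventually_ge_atTop 1,
    Real.tendsto_log_atTop.eventually_gt_atTop 0] with τ h1 h2 h3 h4
  by_contra! hcon
  have h5 := h τ _ h3 h2 fun y hy => hcon y (hy.trans_eq (by rw [div_div_eq_mul_div]; norm_num))
  rw [mul_div_cancel₀ _ (by norm_num), Real.exp_log h4] at h1
  exact absurd h5 (not_le.mpr h1)

lemma norm_Gammaℝ_mul_exp_theta (t : ℝ) :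
    (‖Complex.Gammaℝ (1 / 2 + Complex.I * t)‖ : ℂ) * Complex.exp (Complex.I * theta t) =
      Complex.Gammaℝ (1 / 2 + Complex.I * t) := by
  set G := Complex.Gamma (1 / 4 + Complex.I * t / 2) with hG
  have hs : Complex.Gammaℝ (1 / 2 + Complex.I * t) =
      (Real.pi : ℂ) ^ (-(1 / 2 + Complex.I * t) / 2) * G := by
    rw [Complex.Gammaℝ_def, hG]
    congr 2
    ring
  have hpow : (Real.pi : ℂ) ^ (-(1 / 2 + Complex.I * t) / 2) =
      ((Real.pi ^ (-(1 / 4) : ℝ) : ℝ) : ℂ) *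
        Complex.exp (-(Complex.I * (t / 2 * Real.log Real.pi : ℝ))) := by
    have hpi : (Real.pi : ℂ) ≠ 0 := by exact_mod_cast Real.pi_ne_zero
    rw [Complex.ofReal_cpow Real.pi_pos.le, Complex.cpow_def_of_ne_zero hpi,
      Complex.cpow_def_of_ne_zero hpi, ← Complex.exp_add, ← Complex.ofReal_log Real.pi_pos.le]
    congr 1
    push_cast
    ring
  have hn : ‖Complex.Gammaℝ (1 / 2 + Complex.I * t)‖ = Real.pi ^ (-(1 / 4) : ℝ) * ‖G‖ := by
    rw [hs, hpow, norm_mul, norm_mul, Complex.norm_real, Complex.norm_exp]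
    simp [abs_of_pos (Real.rpow_pos_of_pos Real.pi_pos _)]
  have hth : Complex.exp (Complex.I * theta t) =
      Complex.exp (G.arg * Complex.I) *
        Complex.exp (-(Complex.I * (t / 2 * Real.log Real.pi : ℝ))) := by
    rw [theta, Complex.log_im, ← Complex.exp_add]
    congr 1
    push_cast
    ring
  rw [hn, hth, hs, hpow, Complex.ofReal_mul]
  linear_combination (((Real.pi ^ (-(1 / 4) : ℝ) : ℝ) : ℂ) *
    Complex.exp (-(Complex.I * (t / 2 * Real.log Real.pi : ℝ)))) * Complex.norm_mul_exp_arg_mul_I G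

lemma hardyZ_eq (t : ℝ) : hardyZ t =
    (xi (t * Complex.I)).re * ‖(Complex.Gammaℝ (1 / 2 + Complex.I * t))⁻¹‖ / (1 / 4 + t ^ 2) := by
  have hre : 0 < (1 / 2 + Complex.I * (t : ℂ)).re := by simp
  have hG : Complex.Gammaℝ (1 / 2 + Complex.I * t) ≠ 0 := Complex.Gammaℝ_ne_zero_of_re_pos hre
  have hne : ∀ c : ℝ, c ≠ 0 → (t : ℂ) * Complex.I ≠ c := fun c hc h => hc <| by
    simpa using (congrArg Complex.re h).symm
  have e : 1 / 2 + (t : ℂ) * Complex.I = 1 / 2 + Complex.I * t := by ring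
  have hxi := xi_eq_Gammaℝ_mul_riemannZeta (z := t * Complex.I)
    (by simpa using hne (1 / 2) (by norm_num)) (by simpa using hne (-(1 / 2)) (by norm_num))
    (by rwa [e])
  have hsq : (1 / 4 - ((t : ℂ) * Complex.I) ^ 2) = ((1 / 4 + t ^ 2 : ℝ) : ℂ) := by
    push_cast
    linear_combination (-(t : ℂ) ^ 2) * Complex.I_sq
  rw [e, hsq, ← norm_Gammaℝ_mul_exp_theta t, mul_assoc] at hxi
  rw [hxi, Complex.re_ofReal_mul, Complex.re_ofReal_mul, norm_inv, hardyZ]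
  have h1 : ‖Complex.Gammaℝ (1 / 2 + Complex.I * t)‖ ≠ 0 := norm_ne_zero_iff.mpr hG
  have h2 : (1 / 4 + t ^ 2 : ℝ) ≠ 0 := by positivity
  rw [eq_div_iff h2, mul_assoc, mul_right_comm _ _ ‖_‖⁻¹, mul_inv_cancel₀ h1, one_mul, mul_comm]

lemma hardyZ_eq_zero_iff (t : ℝ) : hardyZ t = 0 ↔ xi (t * Complex.I) = 0 := by
  have hG : Complex.Gammaℝ (1 / 2 + Complex.I * t) ≠ 0 :=
    Complex.Gammaℝ_ne_zero_of_re_pos (by simp)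
  have h2 : (1 / 4 + t ^ 2 : ℝ) ≠ 0 := by positivity
  have hreal : (xi (t * Complex.I)).im = 0 := by
    rw [← Complex.conj_eq_iff_im, ← xi_conj]
    simp [xi_neg]
  rw [hardyZ_eq, div_eq_zero_iff, or_iff_left h2, mul_eq_zero,
    or_iff_left (norm_ne_zero_iff.mpr (inv_ne_zero hG)), Complex.ext_iff]
  simp [hreal]

lemma differentiable_hardyZ : Differentiable ℝ hardyZ := by
  intro t
  have hG : Complex.Gammaℝ (1 / 2 + Complex.I * t) ≠ 0 :=
    Complex.Gammaℝ_ne_zero_of_re_pos (by simp)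
  have d1 : DifferentiableAt ℝ (fun t : ℝ => (xi (t * Complex.I)).re) t := by
    have : DifferentiableAt ℂ (fun z : ℂ => xi (z * Complex.I)) (t : ℂ) :=
      DifferentiableAt.comp (f := fun z : ℂ => z * Complex.I) _ (differentiable_xi _)
        (by fun_prop)
    exact Complex.reCLM.differentiableAt.comp t this.hasDerivAt.comp_ofReal.differentiableAt
  have d2 : DifferentiableAt ℝ
      (fun t : ℝ => ‖(Complex.Gammaℝ (1 / 2 + Complex.I * t))⁻¹‖) t := by
    have : DifferentiableAt ℂ (fun z : ℂ => (Complex.Gammaℝ (1 / 2 + Complex.I * z))⁻¹) (t : ℂ) :=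
      DifferentiableAt.comp (f := fun z : ℂ => 1 / 2 + Complex.I * z) _
        (Complex.differentiable_Gammaℝ_inv _) (by fun_prop)
    exact this.hasDerivAt.comp_ofReal.differentiableAt.norm ℝ (inv_ne_zero hG)
  rw [show hardyZ = _ from funext hardyZ_eq]
  exact (d1.mul d2).div (by fun_prop) (by positivity)

lemma exists_xi_mul_I_ne_zero {a b : ℝ} (hab : a < b) :
    ∃ c ∈ Set.Ioo a b, xi (c * Complex.I) ≠ 0 := by
  by_contra! h
  obtain ⟨c, hc⟩ := exists_between hab
  have hT : Tendsto (fun t : ℝ => (t : ℂ) * Complex.I) (𝓝[≠] c) (𝓝[≠] (c * Complex.I)) := by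
    refine tendsto_nhdsWithin_iff.mpr ⟨?_, ?_⟩
    · exact (Continuous.tendsto (by fun_prop) c).mono_left nhdsWithin_le_nhds
    · filter_upwards [self_mem_nhdsWithin] with t ht h'
      exact ht (by simpa using h')
  have hev : ∀ᶠ t : ℝ in 𝓝[≠] c, xi (t * Complex.I) = 0 :=
    nhdsWithin_le_nhds (mem_of_superset (Ioo_mem_nhds hc.1 hc.2) fun t ht => h t ht)
  have h0 := AnalyticOnNhd.eq_of_frequently_eq (f := xi) (g := fun _ => 0)
    (fun z _ => differentiable_xi.analyticAt z) analyticOnNhd_const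
    (hT.frequently hev.frequently)
  have h1 := xi_half
  rw [h0] at h1
  norm_num at h1

lemma exists_deriv_mul_deriv_neg {f : ℝ → ℝ} (hf : Differentiable ℝ f) {a b c : ℝ}
    (hac : a < c) (hcb : c < b) (ha : f a = 0) (hb : f b = 0) (hc : f c ≠ 0) :
    ∃ t₁ t₂, a < t₁ ∧ t₁ < t₂ ∧ t₂ < b ∧ deriv f t₁ * deriv f t₂ < 0 := by
  obtain ⟨t₁, h₁, e₁⟩ := exists_deriv_eq_slope f hac hf.continuous.continuousOn
    hf.differentiableOn
  obtain ⟨t₂, h₂, e₂⟩ := exists_deriv_eq_slope f hcb hf.continuous.continuousOn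
    hf.differentiableOn
  refine ⟨t₁, t₂, h₁.1, h₁.2.trans h₂.1, h₂.2, ?_⟩
  have hac' := sub_pos.mpr hac
  have hcb' := sub_pos.mpr hcb
  rw [e₁, e₂, ha, hb, div_mul_div_comm]
  exact div_neg_of_neg_of_pos (by have := sq_pos_of_ne_zero hc; nlinarith) (by positivity)

/-- On RH, there is `A > 0` such that for all sufficiently large `T` the interval
`(T, T + 2A/ln ln T)` contains a root of odd order of `Z'(t) = 0`, witnessed by a sign
change of `Z'`. -/
theorem Zprime_sign_change_RH (RH : RiemannHypothesis) :
    ∃ A > (0:ℝ), ∀ᶠ T in Filter.atTop, ∃ t₁ t₂ : ℝ,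
      T < t₁ ∧ t₁ < t₂ ∧ t₂ < T + 2 * A / Real.log (Real.log T) ∧
      deriv hardyZ t₁ * deriv hardyZ t₂ < 0 := by
  refine ⟨480, by norm_num, ?_⟩
  obtain ⟨N, hN⟩ := eventually_atTop.mp (eventually_exists_xi_eq_zero RH)
  filter_upwards [eventually_ge_atTop N, eventually_gt_atTop 0,
    Real.tendsto_log_atTop.eventually_gt_atTop 1] with T hTN hT0 hlog
  set r : ℝ := 1 / Real.log (Real.log T) with hr
  have hLL : 0 < Real.log (Real.log T) := Real.log_pos hlog
  have hr0 : 0 < r := by positivity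
  have hzero : ∀ k : ℝ, 0 ≤ k → ∃ y, |y - (T + k * r)| ≤ 120 * r ∧ hardyZ y = 0 := by
    intro k hk
    have hT : T ≤ T + k * r := by have := mul_nonneg hk hr0.le; linarith
    obtain ⟨y, hy, hy0⟩ := hN (T + k * r) (hTN.trans hT)
    refine ⟨y, hy.trans ?_, (hardyZ_eq_zero_iff y).mpr hy0⟩
    have hLL' : Real.log (Real.log T) ≤ Real.log (Real.log (T + k * r)) :=
      Real.log_le_log (by linarith) (Real.log_le_log hT0 hT)
    calc _ ≤ 120 / Real.log (Real.log T) := div_le_div_of_nonneg_left (by norm_num) hLL hLL'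
      _ = 120 * r := by rw [hr, mul_one_div]
  obtain ⟨y₁, h₁, z₁⟩ := hzero 240 (by norm_num)
  obtain ⟨y₂, h₂, z₂⟩ := hzero 720 (by norm_num)
  rw [abs_le] at h₁ h₂
  obtain ⟨c, hc, hcne⟩ := exists_xi_mul_I_ne_zero (show y₁ < y₂ by linarith)
  obtain ⟨t₁, t₂, ha, hb, hd, hneg⟩ := exists_deriv_mul_deriv_neg differentiable_hardyZ hc.1 hc.2
    z₁ z₂ (fun h => hcne ((hardyZ_eq_zero_iff c).mp h))
  have e : 2 * 480 / Real.log (Real.log T) = 960 * r := by rw [hr]; ring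
  exact ⟨t₁, t₂, by linarith, hb, by rw [e]; linarith, hneg⟩
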